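/- arXiv:2311.18096 — 4 statements merged into one kernel-verified Lean document; each statement's English description precedes it below -/
import Mathlib

section
/- Let n, N be positive integers, δ ∈ (0,1), and σ > 0. Let Ψ be a random n×N real matrix whose entries are i.i.d. N(0, σ²) Gaussian random variables. Then with probability at least 1−δ, √(λ_min(Ψ Ψᵀ)) ≥ σ(√N − √n − √(2·log(1/δ))). -/
open Matrix MeasureTheory ProbabilityTheory

/-- The smallest eigenvalue of a (Hermitian/symmetric) real matrix; junk value `0`
if the matrix is not Hermitian. -/
noncomputable def lamMin {n : Type*} [Fintype n] [DecidableEq n]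
    (S : Matrix n n ℝ) : ℝ :=
  if h : S.IsHermitian then ⨅ i, h.eigenvalues i else 0

/-- The standard Gaussian measure on `κ → ℝ`. -/
noncomputable abbrev stdPi (κ : Type*) [Fintype κ] : Measure (κ → ℝ) :=
  Measure.pi fun _ => gaussianReal 0 1

/-- Measurable functions of at most exponential growth. -/
def Tame {ι : Type*} [Fintype ι] (f : (ι → ℝ) → ℝ) : Prop :=
  Measurable f ∧ ∃ C c : ℝ, 0 ≤ C ∧ 0 ≤ c ∧ ∀ x, |f x| ≤ C * Real.exp (c * ∑ a, |x a|)

namespace Tame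

variable {ι κ : Type*} [Fintype ι] [Fintype κ] {f g : (ι → ℝ) → ℝ}

lemma of_bounded (hf : Measurable f) (C : ℝ) (hC : ∀ x, |f x| ≤ C) : Tame f :=
  ⟨hf, |C|, 0, abs_nonneg _, le_rfl, fun x => by simpa using (hC x).trans (le_abs_self C)⟩

lemma const (c : ℝ) : Tame (fun _ : ι → ℝ => c) :=
  of_bounded measurable_const |c| fun _ => le_rfl

lemma add (hf : Tame f) (hg : Tame g) : Tame (fun x => f x + g x) := by
  obtain ⟨mf, C, c, hC, hc, hf⟩ := hf
  obtain ⟨mg, C', c', hC', hc', hg⟩ := hg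
  refine ⟨mf.add mg, C + C', c + c', by positivity, by positivity, fun x => ?_⟩
  have hs : 0 ≤ ∑ a, |x a| := Finset.sum_nonneg fun _ _ => abs_nonneg _
  have h1 : Real.exp (c * ∑ a, |x a|) ≤ Real.exp ((c + c') * ∑ a, |x a|) := by
    gcongr; linarith
  have h2 : Real.exp (c' * ∑ a, |x a|) ≤ Real.exp ((c + c') * ∑ a, |x a|) := by
    gcongr; linarith
  calc |f x + g x| ≤ |f x| + |g x| := abs_add_le _ _
    _ ≤ C * Real.exp (c * ∑ a, |x a|) + C' * Real.exp (c' * ∑ a, |x a|) :=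
      add_le_add (hf x) (hg x)
    _ ≤ C * Real.exp ((c + c') * ∑ a, |x a|) + C' * Real.exp ((c + c') * ∑ a, |x a|) := by
      gcongr
    _ = _ := by ring

lemma mul (hf : Tame f) (hg : Tame g) : Tame (fun x => f x * g x) := by
  obtain ⟨mf, C, c, hC, hc, hf⟩ := hf
  obtain ⟨mg, C', c', hC', hc', hg⟩ := hg
  refine ⟨mf.mul mg, C * C', c + c', by positivity, by positivity, fun x => ?_⟩
  rw [abs_mul, add_mul, Real.exp_add]
  calc |f x| * |g x| ≤ (C * Real.exp (c * ∑ a, |x a|)) * (C' * Real.exp (c' * ∑ a, |x a|)) :=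
      mul_le_mul (hf x) (hg x) (abs_nonneg _) (by positivity)
    _ = _ := by ring

lemma sum {α : Type*} {s : Finset α} {F : α → (ι → ℝ) → ℝ} (h : ∀ i ∈ s, Tame (F i)) :
    Tame (fun x => ∑ i ∈ s, F i x) := by
  classical
  induction s using Finset.induction_on with
  | empty => simpa using const 0
  | insert a s ha ih =>
    simp only [Finset.sum_insert ha]
    exact (h a (by simp)).add (ih fun i hi => h i (by simp [hi]))

lemma abs_coord (a : ι) : Tame (fun x : ι → ℝ => |x a|) := by
  refine ⟨by fun_prop, 1, 1, by norm_num, by norm_num, fun x => ?_⟩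
  have : |x a| ≤ ∑ b, |x b| :=
    Finset.single_le_sum (f := fun b => |x b|) (fun _ _ => abs_nonneg _) (Finset.mem_univ a)
  rw [abs_abs, one_mul, one_mul]
  linarith [Real.add_one_le_exp (∑ b, |x b|)]

lemma mono (hg : Tame g) (hf : Measurable f) (h : ∀ x, |f x| ≤ |g x|) : Tame f := by
  obtain ⟨_, C, c, hC, hc, hg⟩ := hg
  exact ⟨hf, C, c, hC, hc, fun x => (h x).trans (hg x)⟩

lemma coord (a : ι) : Tame (fun x : ι → ℝ => x a) :=
  (abs_coord a).mono (by fun_prop) fun x => by simp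

lemma comp (hf : Tame f) {T : (κ → ℝ) → ι → ℝ} (hT : Measurable T) (c : ℝ) (hc : 0 ≤ c)
    (h : ∀ ξ a, |T ξ a| ≤ c * ∑ k, |ξ k|) : Tame (fun ξ => f (T ξ)) := by
  obtain ⟨mf, C, c', hC, hc', hf⟩ := hf
  refine ⟨mf.comp hT, C, c' * (Fintype.card ι * c), hC, by positivity, fun ξ => ?_⟩
  refine (hf _).trans ?_
  have : ∑ a, |T ξ a| ≤ Fintype.card ι * c * ∑ k, |ξ k| := by
    calc ∑ a, |T ξ a| ≤ ∑ _a : ι, c * ∑ k, |ξ k| := Finset.sum_le_sum fun a _ => h ξ a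
      _ = _ := by simp [mul_assoc]
  rw [mul_assoc c']
  gcongr

lemma exp_of_le (hf : Measurable f) (C c : ℝ) (hc : 0 ≤ c)
    (h : ∀ x, f x ≤ C + c * ∑ a, |x a|) : Tame (fun x => Real.exp (f x)) :=
  ⟨hf.exp, Real.exp C, c, (Real.exp_pos _).le, hc, fun x => by
    rw [abs_of_pos (Real.exp_pos _), ← Real.exp_add]
    exact Real.exp_le_exp.2 (h x)⟩

lemma integrable (hf : Tame f) : Integrable f (stdPi ι) := by
  obtain ⟨mf, C, c, hC, hc, hf⟩ := hf
  have h1 : Integrable (fun t : ℝ => Real.exp (c * |t|)) (gaussianReal 0 1) :=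
    integrable_exp_mul_abs (X := id) (integrable_exp_mul_gaussianReal c)
      (integrable_exp_mul_gaussianReal (-c))
  have h2 : Integrable (fun x : ι → ℝ => C * ∏ a, Real.exp (c * |x a|)) (stdPi ι) :=
    (Integrable.fintype_prod (f := fun _ t => Real.exp (c * |t|)) fun _ => h1).const_mul C
  refine h2.mono' mf.aestronglyMeasurable (ae_of_all _ fun x => ?_)
  rw [Real.norm_eq_abs]
  refine (hf x).trans_eq ?_
  rw [← Real.exp_sum, Finset.mul_sum]

end Tame

lemma integral_mul_gaussianReal {f f' : ℝ → ℝ} (hf : ∀ t, HasDerivAt f (f' t) t)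
    (hf'm : Measurable f') (C c : ℝ) (hb : ∀ t, |f t| ≤ C * Real.exp (c * |t|))
    (hb' : ∀ t, |f' t| ≤ C * Real.exp (c * |t|)) :
    ∫ t, t * f t ∂(gaussianReal 0 1) = ∫ t, f' t ∂(gaussianReal 0 1) := by
  have hfm : Measurable f :=
    (continuous_iff_continuousAt.2 fun t => (hf t).continuousAt).measurable
  have hφ : ∀ t, gaussianPDFReal 0 1 t
      = (Real.sqrt (2 * Real.pi))⁻¹ * Real.exp (-t ^ 2 / 2) := by
    intro t; simp [gaussianPDFReal_def]
  have hdφ : ∀ t, HasDerivAt (gaussianPDFReal 0 1) (-t * gaussianPDFReal 0 1 t) t := by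
    intro t
    have h1 : HasDerivAt (fun t : ℝ => -t ^ 2 / 2) (-t) t := by
      refine (((hasDerivAt_pow 2 t).neg).div_const 2).congr_deriv ?_
      simp; ring
    have h2 := (h1.exp).const_mul (Real.sqrt (2 * Real.pi))⁻¹
    rw [show gaussianPDFReal 0 1 = fun t => (Real.sqrt (2 * Real.pi))⁻¹ * Real.exp (-t ^ 2 / 2)
      from funext hφ]
    exact h2.congr_deriv (by ring)
  have hI : ∀ (d : ℝ) , Integrable (fun t : ℝ => Real.exp (d * |t|)) (gaussianReal 0 1) :=
    fun d => integrable_exp_mul_abs (X := id) (integrable_exp_mul_gaussianReal d)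
      (integrable_exp_mul_gaussianReal (-d))
  have key : ∀ g : ℝ → ℝ, Integrable g (gaussianReal 0 1) →
      Integrable (fun t => gaussianPDFReal 0 1 t * g t) := by
    intro g hg
    rw [gaussianReal_of_var_ne_zero _ one_ne_zero] at hg
    rw [integrable_withDensity_iff_integrable_smul' (measurable_gaussianPDF 0 1)
      (ae_of_all _ fun _ => gaussianPDF_lt_top)] at hg
    simpa [toReal_gaussianPDF] using hg
  have I1 : Integrable f (gaussianReal 0 1) :=
    ((hI c).const_mul C).mono' hfm.aestronglyMeasurable (ae_of_all _ hb)
  have I2 : Integrable f' (gaussianReal 0 1) :=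
    ((hI c).const_mul C).mono' hf'm.aestronglyMeasurable (ae_of_all _ hb')
  have I3 : Integrable (fun t => t * f t) (gaussianReal 0 1) := by
    refine ((hI (1 + c)).const_mul C).mono' (by fun_prop) (ae_of_all _ fun t => ?_)
    rw [Real.norm_eq_abs, abs_mul, add_mul, Real.exp_add]
    have h1 : |t| ≤ Real.exp (1 * |t|) := by rw [one_mul]; linarith [Real.add_one_le_exp |t|]
    calc |t| * |f t| ≤ Real.exp (1 * |t|) * (C * Real.exp (c * |t|)) :=
          mul_le_mul h1 (hb t) (abs_nonneg _) (Real.exp_pos _).le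
      _ = _ := by ring
  rw [integral_gaussianReal_eq_integral_smul one_ne_zero,
    integral_gaussianReal_eq_integral_smul one_ne_zero]
  have := integral_mul_deriv_eq_deriv_mul_of_integrable (u := f) (v := gaussianPDFReal 0 1)
    (u' := f') (v' := fun t => -t * gaussianPDFReal 0 1 t)
    (fun t _ => hf t) (fun t _ => hdφ t)
    ((key _ I3).neg.congr (ae_of_all _ fun t => by simp; ring))
    ((key _ I2).congr (ae_of_all _ fun t => by simp; ring))
    ((key _ I1).congr (ae_of_all _ fun t => by simp; ring))
  simp only [smul_eq_mul]
  calc ∫ t, gaussianPDFReal 0 1 t * (t * f t)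
      = - ∫ t, f t * (-t * gaussianPDFReal 0 1 t) := by
        rw [← integral_neg]; congr 1; ext t; ring
    _ = ∫ t, f' t * gaussianPDFReal 0 1 t := by rw [this, neg_neg]
    _ = _ := by congr 1; ext t; ring

lemma measurePreserving_update {κ : Type*} [Fintype κ] [DecidableEq κ] (k : κ) :
    MeasurePreserving (fun p : (κ → ℝ) × ℝ => Function.update p.1 k p.2)
      ((stdPi κ).prod (gaussianReal 0 1)) (stdPi κ) := by
  have hm : Measurable (fun p : (κ → ℝ) × ℝ => Function.update p.1 k p.2) := by
    rw [measurable_pi_iff]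
    intro a
    by_cases h : a = k
    · subst h; simpa using measurable_snd
    · simp only [Function.update_of_ne h]; fun_prop
  refine ⟨hm, (Measure.pi_eq fun s hs => ?_).symm⟩
  rw [Measure.map_apply hm (MeasurableSet.univ_pi hs)]
  have : (fun p : (κ → ℝ) × ℝ => Function.update p.1 k p.2) ⁻¹' Set.univ.pi s
      = (Set.univ.pi (Function.update s k Set.univ)) ×ˢ (s k) := by
    ext p
    simp only [Set.mem_preimage, Set.mem_pi, Set.mem_univ, true_implies, Set.mem_prod]
    constructor
    · intro h
      refine ⟨fun i => ?_, by simpa using h k⟩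
      by_cases hi : i = k
      · subst hi; simp
      · simpa [Function.update_of_ne hi] using h i
    · rintro ⟨h, h'⟩ i
      by_cases hi : i = k
      · subst hi; simpa using h'
      · simpa [Function.update_of_ne hi] using h i
  rw [this, Measure.prod_prod, Measure.pi_pi, ← Finset.mul_prod_erase _ _ (Finset.mem_univ k),
    ← Finset.mul_prod_erase Finset.univ (fun i => gaussianReal 0 1 (s i)) (Finset.mem_univ k)]
  simp only [Function.update_self, measure_univ, one_mul]
  rw [mul_comm]
  congr 1
  refine Finset.prod_congr rfl fun i hi => ?_
  rw [Function.update_of_ne (Finset.ne_of_mem_erase hi)]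

lemma Tame.exists_update_bound {κ : Type*} [Fintype κ] [DecidableEq κ] {H : (κ → ℝ) → ℝ}
    (hH : Tame H) (k : κ) (ξ : κ → ℝ) :
    ∃ C c : ℝ, 0 ≤ C ∧ 0 ≤ c ∧ ∀ t, |H (Function.update ξ k t)| ≤ C * Real.exp (c * |t|) := by
  obtain ⟨_, C, c, hC, hc, h⟩ := hH
  refine ⟨C * Real.exp (c * ∑ a, |ξ a|), c, by positivity, hc, fun t => (h _).trans ?_⟩
  rw [mul_assoc, ← Real.exp_add, ← mul_add]
  gcongr
  rw [← Finset.add_sum_erase _ _ (Finset.mem_univ k), Function.update_self, add_comm]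
  gcongr
  refine le_trans (le_of_eq (Finset.sum_congr rfl fun i hi => ?_))
    (Finset.sum_le_sum_of_subset_of_nonneg (Finset.erase_subset k Finset.univ)
      fun i _ _ => abs_nonneg (ξ i))
  rw [Function.update_of_ne (Finset.ne_of_mem_erase hi)]

/-- Gaussian integration by parts in one coordinate. -/
lemma integral_coord_mul_stdPi {κ : Type*} [Fintype κ] [DecidableEq κ] (k : κ)
    {H H' : (κ → ℝ) → ℝ} (hH : Tame H) (hH' : Tame H')
    (hd : ∀ ξ t, HasDerivAt (fun s => H (Function.update ξ k s)) (H' (Function.update ξ k t)) t) :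
    ∫ ξ, ξ k * H ξ ∂(stdPi κ) = ∫ ξ, H' ξ ∂(stdPi κ) := by
  have mp := measurePreserving_update k
  have e1 : ∀ f : (κ → ℝ) → ℝ, Tame f → ∫ ξ, f ξ ∂(stdPi κ)
      = ∫ ξ, ∫ t, f (Function.update ξ k t) ∂(gaussianReal 0 1) ∂(stdPi κ) := by
    intro f hf
    rw [← integral_prod (f := fun p : (κ → ℝ) × ℝ => f (Function.update p.1 k p.2))
      (mp.integrable_comp_of_integrable hf.integrable)]
    conv_lhs => rw [← mp.map_eq]
    exact integral_map mp.measurable.aemeasurable hf.1.aestronglyMeasurable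
  rw [e1 _ ((Tame.coord k).mul hH), e1 _ hH']
  congr 1
  ext ξ
  simp only [Function.update_self]
  obtain ⟨C, c, hC, hc, hb⟩ := hH.exists_update_bound k ξ
  obtain ⟨C', c', hC', hc', hb'⟩ := hH'.exists_update_bound k ξ
  have hm : Measurable fun t : ℝ => Function.update ξ k t := measurable_update ξ
  have aux : ∀ (D d t : ℝ), 0 ≤ D → d ≤ max c c' → D ≤ max C C' →
      D * Real.exp (d * |t|) ≤ max C C' * Real.exp (max c c' * |t|) := by
    intro D d t hD h1 h2
    gcongr
  exact integral_mul_gaussianReal (hd ξ) (hH'.1.comp hm) (max C C') (max c c')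
    (fun t => (hb t).trans (aux _ _ _ hC (le_max_left _ _) (le_max_left _ _)))
    (fun t => (hb' t).trans (aux _ _ _ hC' (le_max_right _ _) (le_max_right _ _)))

/-- `F1` collects the partial derivatives of `F`, in the form of the chain rule along curves. -/
def HasPartials {ι : Type*} [Fintype ι] (F : (ι → ℝ) → ℝ) (F1 : ι → (ι → ℝ) → ℝ) : Prop :=
  ∀ (c : ℝ → ι → ℝ) (c' : ι → ℝ) (t : ℝ), (∀ a, HasDerivAt (fun s => c s a) (c' a) t) →
    HasDerivAt (fun s => F (c s)) (∑ a, F1 a (c t) * c' a) t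

section Interpolation

variable {ι κ : Type*} [Fintype ι] [Fintype κ]

lemma abs_sum_mul_le (L : κ → ℝ) (ξ : κ → ℝ) :
    |∑ k, L k * ξ k| ≤ (∑ k, |L k|) * ∑ k, |ξ k| := by
  refine (Finset.abs_sum_le_sum_abs _ _).trans ?_
  rw [Finset.sum_mul]
  refine Finset.sum_le_sum fun k _ => ?_
  rw [abs_mul]
  gcongr
  exact Finset.single_le_sum (f := fun b => |ξ b|) (fun _ _ => abs_nonneg _) (Finset.mem_univ k)

lemma Tame.comp_linear {f : (ι → ℝ) → ℝ} (hf : Tame f) (L : ι → κ → ℝ) :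
    Tame (fun ξ : κ → ℝ => f fun a => ∑ k, L a k * ξ k) := by
  refine hf.comp (by fun_prop) (∑ a, ∑ k, |L a k|) (by positivity) fun ξ a => ?_
  refine (abs_sum_mul_le _ _).trans ?_
  gcongr
  exact Finset.single_le_sum (f := fun a => ∑ k, |L a k|) (fun _ _ => by positivity)
    (Finset.mem_univ a)

/-- Gaussian integration by parts for a function of a linear image. -/
lemma integral_coord_mul_comp_linear {F : (ι → ℝ) → ℝ} {F1 : ι → (ι → ℝ) → ℝ}
    (hF : Tame F) (hF1 : ∀ a, Tame (F1 a)) (h1 : HasPartials F F1) (L : ι → κ → ℝ) (k : κ) :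
    ∫ ξ, ξ k * F (fun a => ∑ j, L a j * ξ j) ∂(stdPi κ)
      = ∫ ξ, ∑ a, F1 a (fun a => ∑ j, L a j * ξ j) * L a k ∂(stdPi κ) := by
  classical
  refine integral_coord_mul_stdPi k (hF.comp_linear L)
    (Tame.sum fun a _ => ((hF1 a).comp_linear L).mul (Tame.const _)) fun ξ t => ?_
  refine h1 (fun s a => ∑ j, L a j * Function.update ξ k s j) (fun a => L a k) t fun a => ?_
  have : ∀ j ∈ Finset.univ, HasDerivAt (fun s => L a j * Function.update ξ k s j)
      (L a j * if j = k then 1 else 0) t := by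
    intro j _
    refine HasDerivAt.const_mul _ ?_
    by_cases h : j = k
    · subst h; simpa using hasDerivAt_id' t
    · simpa [Function.update_of_ne h, h] using hasDerivAt_const t (ξ j)
  simpa using HasDerivAt.fun_sum this

variable {F : (ι → ℝ) → ℝ} {F1 : ι → (ι → ℝ) → ℝ} {F2 : ι → ι → (ι → ℝ) → ℝ}

lemma hasDerivAt_gaussian_interpolation (A B : ι → κ → ℝ) (hAB : ∀ a b, ∑ k, A a k * B b k = 0)
    (hF : Tame F) (hF1 : ∀ a, Tame (F1 a)) (hF2 : ∀ a b, Tame (F2 a b))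
    (h1 : HasPartials F F1) (h2 : ∀ a, HasPartials (F1 a) (F2 a)) (θ : ℝ) :
    HasDerivAt (fun θ => ∫ ξ, F (fun a => ∑ k, (Real.sin θ * A a k + Real.cos θ * B a k) * ξ k)
        ∂(stdPi κ))
      (Real.sin θ * Real.cos θ * ∫ ξ, ∑ a, ∑ b, (∑ k, A a k * A b k - ∑ k, B a k * B b k) *
        F2 a b (fun a => ∑ k, (Real.sin θ * A a k + Real.cos θ * B a k) * ξ k) ∂(stdPi κ)) θ := by
  set L : ℝ → ι → κ → ℝ := fun θ a k => Real.sin θ * A a k + Real.cos θ * B a k with hL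
  set L' : ℝ → ι → κ → ℝ := fun θ a k => Real.cos θ * A a k - Real.sin θ * B a k with hL'
  set T : (κ → ℝ) → ι → ℝ := fun ξ a => ∑ k, (|A a k| + |B a k|) * |ξ k| with hT
  have hTnn : ∀ ξ a, 0 ≤ T ξ a := fun ξ a => by positivity
  have sc : ∀ θ, |Real.sin θ| ≤ 1 ∧ |Real.cos θ| ≤ 1 := fun θ =>
    ⟨Real.abs_sin_le_one θ, Real.abs_cos_le_one θ⟩
  have hLT : ∀ θ ξ a, |∑ k, L θ a k * ξ k| ≤ T ξ a := by
    intro θ ξ a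
    refine (Finset.abs_sum_le_sum_abs _ _).trans (Finset.sum_le_sum fun k _ => ?_)
    rw [abs_mul]
    gcongr
    refine (abs_add_le _ _).trans ?_
    rw [abs_mul, abs_mul]
    exact add_le_add (mul_le_of_le_one_left (abs_nonneg _) (sc θ).1)
      (mul_le_of_le_one_left (abs_nonneg _) (sc θ).2)
  have hLT' : ∀ θ ξ a, |∑ k, L' θ a k * ξ k| ≤ T ξ a := by
    intro θ ξ a
    refine (Finset.abs_sum_le_sum_abs _ _).trans (Finset.sum_le_sum fun k _ => ?_)
    rw [abs_mul]
    gcongr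
    refine (abs_sub _ _).trans ?_
    rw [abs_mul, abs_mul]
    exact add_le_add (mul_le_of_le_one_left (abs_nonneg _) (sc θ).2)
      (mul_le_of_le_one_left (abs_nonneg _) (sc θ).1)
  have hTtame : ∀ f : (ι → ℝ) → ℝ, Tame f → Tame (fun ξ => f (T ξ)) := by
    intro f hf
    refine hf.comp (by fun_prop) (∑ a, ∑ k, (|A a k| + |B a k|)) (by positivity) fun ξ a => ?_
    have := abs_sum_mul_le (fun k => |A a k| + |B a k|) (fun k => |ξ k|)
    simp only [abs_abs] at this
    refine this.trans ?_
    gcongr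
    refine le_trans (le_of_eq (Finset.sum_congr rfl fun k _ => abs_of_nonneg (by positivity)))
      (Finset.single_le_sum (f := fun a => ∑ k, (|A a k| + |B a k|)) (fun _ _ => by positivity)
      (Finset.mem_univ a))
  choose m1 C c hC hc hb using hF1
  have hF1 : ∀ a, Tame (F1 a) := fun a => ⟨m1 a, C a, c a, hC a, hc a, hb a⟩
  have hbT : Tame (fun x : ι → ℝ => ∑ a, (C a * Real.exp (c a * ∑ b, |x b|)) * |x a|) := by
    refine Tame.sum fun a _ => Tame.mul ((Tame.const _).mul ?_) (Tame.abs_coord a)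
    exact Tame.exp_of_le (by fun_prop) 0 (c a) (hc a) fun x => by simp
  have main := hasDerivAt_integral_of_dominated_loc_of_deriv_le (μ := stdPi κ)
    (F := fun θ ξ => F fun a => ∑ k, L θ a k * ξ k)
    (F' := fun θ ξ => ∑ a, F1 a (fun a => ∑ k, L θ a k * ξ k) * ∑ k, L' θ a k * ξ k)
    (x₀ := θ) (s := Set.univ) (bound := fun ξ => ∑ a, (C a * Real.exp (c a * ∑ b, |T ξ b|)) * |T ξ a|)
    Filter.univ_mem
    (Filter.Eventually.of_forall fun θ => (hF.comp_linear (L θ)).1.aestronglyMeasurable)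
    (hF.comp_linear (L θ)).integrable
    ?_ ?_ (hTtame _ hbT).integrable ?_
  · refine main.2.congr_deriv ?_
    have tz : ∀ a k, Tame (fun ξ : κ → ℝ => ξ k * F1 a (fun a => ∑ k, L θ a k * ξ k)) :=
      fun a k => (Tame.coord k).mul ((hF1 a).comp_linear (L θ))
    have e1 : ∀ ξ : κ → ℝ, ∑ a, F1 a (fun a => ∑ k, L θ a k * ξ k) * ∑ k, L' θ a k * ξ k
        = ∑ a, ∑ k, L' θ a k * (ξ k * F1 a (fun a => ∑ k, L θ a k * ξ k)) := by
      intro ξ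
      refine Finset.sum_congr rfl fun a _ => ?_
      rw [Finset.mul_sum]
      exact Finset.sum_congr rfl fun k _ => by ring
    have t2 : ∀ a k, Tame (fun ξ : κ → ℝ =>
        ∑ b, F2 a b (fun a => ∑ j, L θ a j * ξ j) * L θ b k) := fun a k =>
      Tame.sum fun b _ => ((hF2 a b).comp_linear _).mul (Tame.const _)
    simp_rw [e1]
    rw [integral_finsetSum _ fun a _ => (Tame.sum fun k _ => (Tame.const _).mul (tz a k)).integrable]
    simp_rw [fun a => integral_finsetSum (μ := stdPi κ) Finset.univ (fun k (_ : k ∈ Finset.univ) =>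
      ((Tame.const (L' θ a k)).mul (tz a k)).integrable), integral_const_mul,
      fun a k => integral_coord_mul_comp_linear (hF1 a) (hF2 a) (h2 a) (L θ) k,
      ← integral_const_mul]
    simp_rw [fun a => (integral_finsetSum (μ := stdPi κ) Finset.univ
      (fun k (_ : k ∈ Finset.univ) => ((Tame.const (L' θ a k)).mul (t2 a k)).integrable)).symm]
    rw [← integral_finsetSum _ fun a _ =>
      (Tame.sum fun k _ => (Tame.const _).mul (t2 a k)).integrable]
    congr 1
    ext ξ
    rw [Finset.mul_sum]
    refine Finset.sum_congr rfl fun a _ => ?_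
    rw [Finset.mul_sum]
    simp_rw [Finset.mul_sum]
    rw [Finset.sum_comm]
    refine Finset.sum_congr rfl fun b _ => ?_
    have : ∑ k, L' θ a k * L θ b k
        = Real.sin θ * Real.cos θ * (∑ k, A a k * A b k - ∑ k, B a k * B b k) := by
      have e : ∀ k, L' θ a k * L θ b k = Real.sin θ * Real.cos θ * (A a k * A b k)
          - Real.sin θ * Real.cos θ * (B a k * B b k) + Real.cos θ ^ 2 * (A a k * B b k)
          - Real.sin θ ^ 2 * (A b k * B a k) := by
        intro k; simp only [hL, hL']; ring
      simp_rw [e, Finset.sum_sub_distrib, Finset.sum_add_distrib, Finset.sum_sub_distrib,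
        ← Finset.mul_sum, hAB]
      ring
    rw [← mul_assoc, ← this, Finset.sum_mul]
    exact Finset.sum_congr rfl fun k _ => by ring
  · exact (Tame.sum fun a _ => ((hF1 a).comp_linear (L θ)).mul
      (Tame.sum fun k _ => (Tame.const _).mul (Tame.coord k))).1.aestronglyMeasurable
  · refine ae_of_all _ fun ξ θ _ => ?_
    rw [Real.norm_eq_abs]
    refine (Finset.abs_sum_le_sum_abs _ _).trans (Finset.sum_le_sum fun a _ => ?_)
    rw [abs_mul]
    refine mul_le_mul ((hb a _).trans ?_) ((hLT' θ ξ a).trans (le_abs_self _)) (abs_nonneg _)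
      (mul_nonneg (hC a) (Real.exp_pos _).le)
    exact mul_le_mul_of_nonneg_left (Real.exp_le_exp.2 (mul_le_mul_of_nonneg_left
      (Finset.sum_le_sum fun b _ => (hLT θ ξ b).trans (le_abs_self _)) (hc a))) (hC a)
  · refine ae_of_all _ fun ξ θ _ => ?_
    refine h1 (fun θ a => ∑ k, L θ a k * ξ k) (fun a => ∑ k, L' θ a k * ξ k) θ fun a => ?_
    refine HasDerivAt.fun_sum fun k _ => HasDerivAt.mul_const ?_ _
    exact (((Real.hasDerivAt_sin θ).mul_const _).add
      ((Real.hasDerivAt_cos θ).mul_const _)).congr_deriv (by simp only [hL']; ring)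

/-- Gaussian comparison: `A ξ` and `B ξ` are independent, and the difference of their covariances
is tested against the Hessian of `F`. -/
theorem gaussian_comparison (A B : ι → κ → ℝ) (hAB : ∀ a b, ∑ k, A a k * B b k = 0)
    (hF : Tame F) (hF1 : ∀ a, Tame (F1 a)) (hF2 : ∀ a b, Tame (F2 a b))
    (h1 : HasPartials F F1) (h2 : ∀ a, HasPartials (F1 a) (F2 a)) (K : ℝ)
    (hK : ∀ x, ∑ a, ∑ b, (∑ k, A a k * A b k - ∑ k, B a k * B b k) * F2 a b x ≤ K * F x) :
    ∫ ξ, F (fun a => ∑ k, A a k * ξ k) ∂(stdPi κ)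
      ≤ Real.exp (K / 2) * ∫ ξ, F (fun a => ∑ k, B a k * ξ k) ∂(stdPi κ) := by
  set L : ℝ → ι → κ → ℝ := fun θ a k => Real.sin θ * A a k + Real.cos θ * B a k with hL
  set Φ : ℝ → ℝ := fun θ => ∫ ξ, F (fun a => ∑ k, L θ a k * ξ k) ∂(stdPi κ) with hΦ
  set D : ℝ → ℝ := fun θ => ∫ ξ, ∑ a, ∑ b, (∑ k, A a k * A b k - ∑ k, B a k * B b k) *
        F2 a b (fun a => ∑ k, L θ a k * ξ k) ∂(stdPi κ) with hD
  have hder : ∀ θ, HasDerivAt Φ (Real.sin θ * Real.cos θ * D θ) θ := fun θ =>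
    hasDerivAt_gaussian_interpolation A B hAB hF hF1 hF2 h1 h2 θ
  have hDle : ∀ θ, D θ ≤ K * Φ θ := by
    intro θ
    rw [hD, hΦ]
    dsimp only
    rw [← integral_const_mul]
    refine integral_mono ?_ ?_ fun ξ => hK _
    · exact (Tame.sum fun a _ => Tame.sum fun b _ => (Tame.const _).mul
        ((hF2 a b).comp_linear (L θ))).integrable
    · exact ((Tame.const K).mul (hF.comp_linear (L θ))).integrable
  set G : ℝ → ℝ := fun θ => Φ θ * Real.exp (-(K / 2) * Real.sin θ ^ 2) with hG
  have hGd : ∀ θ, HasDerivAt G (Real.sin θ * Real.cos θ * (D θ - K * Φ θ)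
      * Real.exp (-(K / 2) * Real.sin θ ^ 2)) θ := by
    intro θ
    have := (hder θ).mul ((((Real.hasDerivAt_sin θ).pow 2).const_mul (-(K / 2))).exp)
    refine this.congr_deriv ?_
    simp
    ring
  have hanti : AntitoneOn G (Set.Icc 0 (Real.pi / 2)) := by
    refine antitoneOn_of_deriv_nonpos (convex_Icc _ _)
      (fun θ _ => (hGd θ).continuousAt.continuousWithinAt)
      (fun θ _ => (hGd θ).differentiableAt.differentiableWithinAt) fun θ hθ => ?_
    rw [interior_Icc] at hθ
    rw [(hGd θ).deriv]
    have hs := Real.sin_nonneg_of_nonneg_of_le_pi hθ.1.le (by linarith [hθ.2, Real.pi_pos])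
    have hc := Real.cos_nonneg_of_mem_Icc ⟨by linarith [hθ.1, Real.pi_pos], hθ.2.le⟩
    refine mul_nonpos_of_nonpos_of_nonneg (mul_nonpos_of_nonneg_of_nonpos (mul_nonneg hs hc) ?_)
      (Real.exp_pos _).le
    linarith [hDle θ]
  have hp := Real.pi_pos
  have := hanti (Set.left_mem_Icc.2 (by positivity)) (Set.right_mem_Icc.2 (by positivity))
    (by positivity : (0 : ℝ) ≤ Real.pi / 2)
  simp only [hG, hΦ, hL, Real.sin_pi_div_two, Real.cos_pi_div_two, Real.sin_zero, Real.cos_zero,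
    one_mul, zero_mul, add_zero, zero_add, one_pow, mul_one, mul_zero, ne_eq, OfNat.ofNat_ne_zero,
    not_false_eq_true, zero_pow, Real.exp_zero] at this
  calc _ = Real.exp (K / 2) * ((∫ ξ, F (fun a => ∑ k, A a k * ξ k) ∂(stdPi κ))
        * Real.exp (-(K / 2))) := by
        rw [mul_left_comm, ← Real.exp_add]; simp
    _ ≤ _ := by gcongr

end Interpolation

namespace HasPartials

variable {ι I J : Type*} [Fintype ι] [Fintype I] [Fintype J]
  {F G : (ι → ℝ) → ℝ} {F1 G1 F1' : ι → (ι → ℝ) → ℝ}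

lemma congr (h : HasPartials F F1) (h' : ∀ a x, F1 a x = F1' a x) : HasPartials F F1' := by
  intro c c' t hc
  simpa only [h'] using h c c' t hc

lemma add (hF : HasPartials F F1) (hG : HasPartials G G1) :
    HasPartials (fun x => F x + G x) (fun a x => F1 a x + G1 a x) := by
  intro c c' t hc
  refine ((hF c c' t hc).add (hG c c' t hc)).congr_deriv ?_
  rw [← Finset.sum_add_distrib]
  exact Finset.sum_congr rfl fun a _ => by ring

lemma mul (hF : HasPartials F F1) (hG : HasPartials G G1) :
    HasPartials (fun x => F x * G x) (fun a x => F1 a x * G x + F x * G1 a x) := by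
  intro c c' t hc
  refine ((hF c c' t hc).mul (hG c c' t hc)).congr_deriv ?_
  rw [Finset.sum_mul, Finset.mul_sum, ← Finset.sum_add_distrib]
  exact Finset.sum_congr rfl fun a _ => by ring

lemma const_mul (hF : HasPartials F F1) (r : ℝ) :
    HasPartials (fun x => r * F x) (fun a x => r * F1 a x) := by
  intro c c' t hc
  refine ((hF c c' t hc).const_mul r).congr_deriv ?_
  rw [Finset.mul_sum]
  exact Finset.sum_congr rfl fun a _ => by ring

lemma sum {α : Type*} (s : Finset α) {F : α → (ι → ℝ) → ℝ} {F1 : α → ι → (ι → ℝ) → ℝ}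
    (h : ∀ i, HasPartials (F i) (F1 i)) :
    HasPartials (fun x => ∑ i ∈ s, F i x) (fun a x => ∑ i ∈ s, F1 i a x) := by
  intro c c' t hc
  refine (HasDerivAt.fun_sum fun i (_ : i ∈ s) => h i c c' t hc).congr_deriv ?_
  rw [Finset.sum_comm]
  exact Finset.sum_congr rfl fun a _ => by rw [Finset.sum_mul]

lemma comp (hF : HasPartials F F1) {g g' : ℝ → ℝ} (hg : ∀ x, HasDerivAt g (g' (F x)) (F x)) :
    HasPartials (fun x => g (F x)) (fun a x => g' (F x) * F1 a x) := by
  intro c c' t hc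
  refine ((hg (c t)).comp t (hF c c' t hc)).congr_deriv ?_
  rw [Finset.mul_sum]
  exact Finset.sum_congr rfl fun a _ => by ring

lemma exp (hF : HasPartials F F1) :
    HasPartials (fun x => Real.exp (F x)) (fun a x => Real.exp (F x) * F1 a x) :=
  hF.comp fun x => Real.hasDerivAt_exp (F x)

lemma log (hF : HasPartials F F1) (h0 : ∀ x, F x ≠ 0) :
    HasPartials (fun x => Real.log (F x)) (fun a x => (F x)⁻¹ * F1 a x) :=
  hF.comp fun x => Real.hasDerivAt_log (h0 x)

lemma const (r : ℝ) : HasPartials (fun _ : ι → ℝ => r) (fun _ _ => 0) := by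
  intro c c' t hc
  simpa using hasDerivAt_const t r

lemma coord [DecidableEq ι] (a : ι) :
    HasPartials (fun x : ι → ℝ => x a) (fun b _ => if b = a then 1 else 0) := by
  intro c c' t hc
  simpa using hc a

lemma slice [DecidableEq I] {f : (J → ℝ) → ℝ} {f1 : J → (J → ℝ) → ℝ} (hf : HasPartials f f1)
    (i : I) : HasPartials (fun x : I × J → ℝ => f fun j => x (i, j))
      (fun a x => if a.1 = i then f1 a.2 (fun j => x (i, j)) else 0) := by
  intro c c' t hc
  refine (hf (fun s j => c s (i, j)) (fun j => c' (i, j)) t fun j => hc (i, j)).congr_deriv ?_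
  rw [Fintype.sum_prod_type, Finset.sum_eq_single i]
  · simp
  · intro b _ hb; simp [hb]
  · simp

end HasPartials

lemma Tame.slice {I J : Type*} [Fintype I] [Fintype J] {f : (J → ℝ) → ℝ} (hf : Tame f) (i : I) :
    Tame (fun x : I × J → ℝ => f fun j => x (i, j)) := by
  refine hf.comp (by fun_prop) 1 zero_le_one fun ξ j => ?_
  rw [one_mul]
  exact Finset.single_le_sum (f := fun b => |ξ b|) (fun _ _ => abs_nonneg _) (Finset.mem_univ (i, j))

/-- A twice differentiable function with bounded first and second partial derivatives `f1`, `f2`. -/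
structure BoundedC2 {J : Type*} [Fintype J] (f : (J → ℝ) → ℝ) (f1 : J → (J → ℝ) → ℝ)
    (f2 : J → J → (J → ℝ) → ℝ) : Prop where
  meas : Measurable f
  meas1 : ∀ j, Measurable (f1 j)
  meas2 : ∀ j k, Measurable (f2 j k)
  part1 : HasPartials f f1
  part2 : ∀ j, HasPartials (f1 j) (f2 j)
  bound1 : ∀ j x, |f1 j x| ≤ 1
  bound2 : ∃ C, ∀ j k x, |f2 j k x| ≤ C
  bound : ∃ C c, 0 ≤ C ∧ 0 ≤ c ∧ ∀ x, |f x| ≤ C + c * ∑ j, |x j|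

namespace BoundedC2

variable {J : Type*} [Fintype J] {f : (J → ℝ) → ℝ} {f1 : J → (J → ℝ) → ℝ}
    {f2 : J → J → (J → ℝ) → ℝ}

lemma tame1 (h : BoundedC2 f f1 f2) (j : J) : Tame (f1 j) :=
  Tame.of_bounded (h.meas1 j) 1 (h.bound1 j)

lemma tame2 (h : BoundedC2 f f1 f2) (j k : J) : Tame (f2 j k) := by
  obtain ⟨C, hC⟩ := h.bound2
  exact Tame.of_bounded (h.meas2 j k) C (hC j k)

lemma tame (h : BoundedC2 f f1 f2) : Tame f := by
  obtain ⟨C, c, hC, hc, hb⟩ := h.bound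
  refine Tame.mono ((Tame.const C).add ((Tame.const c).mul
    (Tame.sum fun j (_ : j ∈ Finset.univ) => Tame.abs_coord j))) h.meas fun x => ?_
  exact (hb x).trans (le_abs_self _)

lemma tame_exp (h : BoundedC2 f f1 f2) (w : ℝ) : Tame fun x => Real.exp (w * f x) := by
  obtain ⟨C, c, hC, hc, hb⟩ := h.bound
  have := h.meas
  refine Tame.exp_of_le (by fun_prop) (|w| * C) (|w| * c) (by positivity) fun x => ?_
  calc w * f x ≤ |w * f x| := le_abs_self _
    _ = |w| * |f x| := abs_mul _ _
    _ ≤ |w| * (C + c * ∑ j, |x j|) := by gcongr; exact hb x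
    _ = _ := by ring

end BoundedC2

/-- The smoothed Euclidean norm `√(ε² + ∑ xⱼ²)`. -/
noncomputable def softNorm {J : Type*} [Fintype J] (ε : ℝ) (x : J → ℝ) : ℝ :=
  Real.sqrt (ε ^ 2 + ∑ j, x j ^ 2)

section SoftNorm

variable {J : Type*} [Fintype J]

lemma softNorm_sq (ε : ℝ) (x : J → ℝ) : softNorm ε x ^ 2 = ε ^ 2 + ∑ j, x j ^ 2 :=
  Real.sq_sqrt (by positivity)

lemma softNorm_nonneg (ε : ℝ) (x : J → ℝ) : 0 ≤ softNorm ε x := Real.sqrt_nonneg _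

lemma le_softNorm {ε : ℝ} (x : J → ℝ) : ε ≤ softNorm ε x :=
  Real.le_sqrt_of_sq_le (by have : 0 ≤ ∑ j, x j ^ 2 := by positivity
                            linarith)

lemma abs_coord_le_softNorm (ε : ℝ) (x : J → ℝ) (j : J) : |x j| ≤ softNorm ε x := by
  refine Real.abs_le_sqrt ?_
  have := Finset.single_le_sum (f := fun b => x b ^ 2) (fun _ _ => sq_nonneg _) (Finset.mem_univ j)
  nlinarith [sq_nonneg ε]

lemma softNorm_zero_le (ε : ℝ) (x : J → ℝ) : softNorm 0 x ≤ softNorm ε x :=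
  Real.sqrt_le_sqrt (by nlinarith [sq_nonneg ε])

lemma softNorm_le {ε : ℝ} (hε : 0 ≤ ε) (x : J → ℝ) : softNorm ε x ≤ softNorm 0 x + ε := by
  refine Real.sqrt_le_iff.2 ⟨add_nonneg (softNorm_nonneg _ _) hε, ?_⟩
  have := softNorm_sq 0 x
  nlinarith [mul_nonneg (softNorm_nonneg 0 x) hε]

lemma softNorm_zero_le_sum (x : J → ℝ) : softNorm 0 x ≤ ∑ j, |x j| := by
  refine Real.sqrt_le_iff.2 ⟨by positivity, ?_⟩
  have := Finset.sum_sq_le_sq_sum_of_nonneg (s := Finset.univ) (f := fun j => |x j|)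
    fun _ _ => abs_nonneg _
  simpa using this

@[fun_prop]
lemma measurable_softNorm (ε : ℝ) : Measurable (softNorm ε : (J → ℝ) → ℝ) := by
  unfold softNorm; fun_prop

lemma hasPartials_softNorm {ε : ℝ} (hε : 0 < ε) :
    HasPartials (softNorm ε : (J → ℝ) → ℝ) (fun j x => x j / softNorm ε x) := by
  intro c c' t hc
  have h1 : HasDerivAt (fun s => ε ^ 2 + ∑ j, c s j ^ 2) (∑ j, 2 * c t j * c' j) t := by
    refine HasDerivAt.const_add _ (HasDerivAt.fun_sum fun j _ => ?_)
    exact ((hc j).pow 2).congr_deriv (by simp)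
  have h0 : ε ^ 2 + ∑ j, c t j ^ 2 ≠ 0 := by positivity
  refine (h1.sqrt h0).congr_deriv ?_
  rw [Finset.sum_div]
  refine Finset.sum_congr rfl fun j _ => ?_
  have : 0 < softNorm ε (c t) := hε.trans_le (le_softNorm _)
  change _ / (2 * softNorm ε (c t)) = _
  field_simp

lemma sum_sq_div_softNorm_le (ε : ℝ) (x : J → ℝ) : ∑ j, (x j / softNorm ε x) ^ 2 ≤ 1 := by
  simp_rw [div_pow]
  rw [← Finset.sum_div]
  refine div_le_one_of_le₀ ?_ (sq_nonneg _)
  rw [softNorm_sq]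
  nlinarith [sq_nonneg ε]

lemma boundedC2_softNorm [DecidableEq J] {ε : ℝ} (hε : 0 < ε) :
    BoundedC2 (softNorm ε : (J → ℝ) → ℝ) (fun j x => x j / softNorm ε x)
      (fun j k x => (if k = j then 1 else 0) * (softNorm ε x)⁻¹
        + x j * (-((softNorm ε x) ^ 2)⁻¹ * (x k / softNorm ε x))) := by
  have pos : ∀ x : J → ℝ, 0 < softNorm ε x := fun x => hε.trans_le (le_softNorm _)
  have hb1 : ∀ j (x : J → ℝ), |x j / softNorm ε x| ≤ 1 := by
    intro j x
    rw [abs_div, abs_of_pos (pos x)]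
    exact div_le_one_of_le₀ (abs_coord_le_softNorm ε x j) (pos x).le
  refine ⟨by fun_prop, fun j => by fun_prop, fun j k => by fun_prop, hasPartials_softNorm hε,
    fun j => ?_, hb1, ⟨ε⁻¹ + ε⁻¹, fun j k x => ?_⟩, ⟨ε, 1, hε.le, zero_le_one, fun x => ?_⟩⟩
  · simp only [div_eq_mul_inv]
    refine ((HasPartials.coord j).mul ((hasPartials_softNorm hε).comp (g := fun y => y⁻¹)
      (g' := fun y => -(y ^ 2)⁻¹) fun x => hasDerivAt_inv (pos x).ne')).congr fun a x => ?_
    simp only [div_eq_mul_inv]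
  · have hi : (softNorm ε x)⁻¹ ≤ ε⁻¹ := inv_anti₀ hε (le_softNorm x)
    have hi0 : 0 ≤ (softNorm ε x)⁻¹ := inv_nonneg.2 (pos x).le
    refine (abs_add_le _ _).trans (add_le_add ?_ ?_)
    · rw [abs_mul, abs_of_nonneg hi0]
      refine (mul_le_of_le_one_left hi0 ?_).trans hi
      split_ifs <;> simp
    · have : x j * (-((softNorm ε x) ^ 2)⁻¹ * (x k / softNorm ε x))
          = -((x j / softNorm ε x) * (x k / softNorm ε x)) * (softNorm ε x)⁻¹ := by
        field_simp
      rw [this, abs_mul, abs_neg, abs_mul, abs_of_nonneg hi0]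
      refine (mul_le_of_le_one_left hi0 ?_).trans hi
      exact mul_le_one₀ (hb1 j x) (abs_nonneg _) (hb1 k x)
  · rw [abs_of_nonneg (softNorm_nonneg _ _), one_mul, add_comm]
    exact (softNorm_le hε.le x).trans (by gcongr; exact softNorm_zero_le_sum x)

end SoftNorm

/-- Marginals of the standard Gaussian measure are standard Gaussian. -/
lemma measurePreserving_comp_injective {κ κ' : Type*} [Fintype κ] [Fintype κ'] {e : κ' → κ}
    (he : Function.Injective e) :
    MeasurePreserving (fun (ω : κ → ℝ) k => ω (e k)) (stdPi κ) (stdPi κ') := by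
  classical
  have hm : Measurable (fun (ω : κ → ℝ) k => ω (e k)) := by fun_prop
  refine ⟨hm, (Measure.pi_eq fun s hs => ?_).symm⟩
  rw [Measure.map_apply hm (MeasurableSet.univ_pi hs)]
  have : (fun (ω : κ → ℝ) k => ω (e k)) ⁻¹' Set.univ.pi s
      = Set.univ.pi (fun k => ⋂ (k' : κ') (_ : e k' = k), s k') := by
    ext ω
    simp only [Set.mem_preimage, Set.mem_pi, Set.mem_univ, true_implies, Set.mem_iInter]
    constructor
    · rintro h _ k rfl; exact h k
    · intro h k; exact h _ k rfl
  rw [this, Measure.pi_pi, ← Finset.prod_subset (Finset.subset_univ (Finset.univ.image e)),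
    Finset.prod_image he.injOn]
  · refine Finset.prod_congr rfl fun k _ => ?_
    congr 1
    ext y
    simp only [Set.mem_iInter]
    exact ⟨fun h => h k rfl, fun h k' hk' => he hk' ▸ h⟩
  · intro k _ hk
    have : (⋂ (k' : κ') (_ : e k' = k), s k') = Set.univ := by
      refine Set.eq_univ_of_forall fun y => Set.mem_iInter₂.2 fun k' hk' => ?_
      exact absurd (Finset.mem_image.2 ⟨k', Finset.mem_univ _, hk'⟩) hk
    rw [this, measure_univ]

lemma integral_prod_slices {I J : Type*} [Fintype I] [Fintype J] (g : I → (J → ℝ) → ℝ) :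
    ∫ ξ, ∏ i, g i (fun j => ξ (i, j)) ∂(stdPi (I × J)) = ∏ i, ∫ x, g i x ∂(stdPi J) := by
  have h : (stdPi (I × J)).map (MeasurableEquiv.curry I J ℝ) = Measure.pi fun _ : I => stdPi J := by
    have := Measure.infinitePi_map_curry (X := ℝ) (fun (_ : I) (_ : J) => gaussianReal 0 1)
    simpa [Measure.infinitePi_eq_pi] using this
  rw [← integral_fintype_prod_eq_prod, ← h, integral_map_equiv]
  rfl

lemma prod_integral_exp_softNorm_le {I J : Type*} [Fintype I] [Fintype J] {ε : ℝ} (hε : 0 < ε)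
    (w : I → ℝ) (hw : ∑ i, w i = 0) :
    ∏ i, ∫ x, Real.exp (w i * softNorm ε x) ∂(stdPi J) ≤ Real.exp ((∑ i, w i ^ 2) / 2) := by
  classical
  set f : (J → ℝ) → ℝ := softNorm ε with hf
  obtain ⟨f1, hf1⟩ : ∃ f1 : J → (J → ℝ) → ℝ, f1 = fun j x => x j / softNorm ε x := ⟨_, rfl⟩
  obtain ⟨f2, h⟩ : ∃ f2, BoundedC2 f f1 f2 := ⟨_, hf1 ▸ boundedC2_softNorm hε⟩
  have hgrad : ∀ x, ∑ j, f1 j x ^ 2 ≤ 1 := fun x => by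
    subst hf1; exact sum_sq_div_softNorm_le ε x
  set F : (I × J → ℝ) → ℝ := fun x => Real.exp (∑ i, w i * f fun j => x (i, j)) with hF
  set F1 : I × J → (I × J → ℝ) → ℝ := fun a x => F x * (w a.1 * f1 a.2 fun j => x (a.1, j)) with hF1
  set F2 : I × J → I × J → (I × J → ℝ) → ℝ := fun a b x =>
    F1 b x * (w a.1 * f1 a.2 fun j => x (a.1, j)) +
      F x * (w a.1 * if b.1 = a.1 then f2 a.2 b.2 (fun j => x (a.1, j)) else 0) with hF2
  have tF : Tame F := by
    have hFm : Measurable F := by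
      have := h.meas
      fun_prop
    obtain ⟨C, c, hC, hc, hb⟩ := h.bound
    refine Tame.exp_of_le (by have := h.meas; fun_prop) (∑ i, |w i| * C) (∑ i, |w i| * c)
      (by positivity) fun x => ?_
    rw [Finset.sum_mul, ← Finset.sum_add_distrib]
    refine Finset.sum_le_sum fun i _ => ?_
    have hs : ∑ j, |x (i, j)| ≤ ∑ a, |x a| := by
      rw [Fintype.sum_prod_type]
      exact Finset.single_le_sum (f := fun i => ∑ j, |x (i, j)|) (fun _ _ => by positivity)
        (Finset.mem_univ i)
    calc w i * f (fun j => x (i, j)) ≤ |w i| * |f (fun j => x (i, j))| := by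
          rw [← abs_mul]; exact le_abs_self _
      _ ≤ |w i| * (C + c * ∑ a, |x a|) := by
          gcongr; exact (hb _).trans (by gcongr)
      _ = _ := by ring
  have tF1 : ∀ a, Tame (F1 a) := fun a =>
    tF.mul ((Tame.const _).mul ((h.tame1 a.2).slice a.1))
  have tF2 : ∀ a b, Tame (F2 a b) := by
    intro a b
    refine ((tF1 b).mul ((Tame.const _).mul ((h.tame1 a.2).slice a.1))).add
      (tF.mul ((Tame.const _).mul ?_))
    split_ifs
    · exact (h.tame2 a.2 b.2).slice a.1
    · exact Tame.const 0
  have p1 : HasPartials F F1 := by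
    refine (HasPartials.sum Finset.univ fun i => ((h.part1.slice i).const_mul (w i))).exp.congr
      fun a x => ?_
    simp [hF1, hF]
  have p2 : ∀ a, HasPartials (F1 a) (F2 a) := fun a =>
    p1.mul (((h.part2 a.2).slice a.1).const_mul (w a.1))
  set A : I × J → Option I × J → ℝ := fun a k => if k = (some a.1, a.2) then 1 else 0 with hA
  set B : I × J → Option I × J → ℝ := fun a k => if k = (none, a.2) then 1 else 0 with hB
  have hAA : ∀ a b, ∑ k, A a k * A b k = if a = b then 1 else 0 := by
    rintro ⟨i, j⟩ ⟨i', j'⟩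
    simp [hA, eq_comm]
  have hBB : ∀ a b, ∑ k, B a k * B b k = if a.2 = b.2 then 1 else 0 := by
    rintro ⟨i, j⟩ ⟨i', j'⟩
    simp [hB, eq_comm]
  have hAB : ∀ a b, ∑ k, A a k * B b k = 0 := by
    rintro ⟨i, j⟩ ⟨i', j'⟩
    simp [hA, hB]
  have main := gaussian_comparison A B hAB tF tF1 tF2 p1 p2 (∑ i, w i ^ 2) fun x => by
    set v : I → J → ℝ := fun i j => w i * f1 j fun j => x (i, j) with hv
    have e : ∀ a b, (∑ k, A a k * A b k - ∑ k, B a k * B b k) * F2 a b x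
        = F x * ((if a = b then v a.1 a.2 * v b.1 b.2 else 0)
          - if a.2 = b.2 then v a.1 a.2 * v b.1 b.2 else 0) := by
      rintro ⟨i, j⟩ ⟨i', j'⟩
      rw [hAA, hBB]
      simp only [hF2, hF1, hv, Prod.mk.injEq]
      by_cases h1 : i = i'
      · by_cases h2 : j = j' <;> simp [h1, h2]
      · have h3 : i' ≠ i := fun h => h1 h.symm
        by_cases h2 : j = j' <;> simp [h1, h2, h3]
        ring
    simp_rw [e, ← Finset.mul_sum]
    rw [mul_comm (∑ i, w i ^ 2)]
    refine mul_le_mul_of_nonneg_left ?_ (Real.exp_pos _).le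
    simp_rw [Finset.sum_sub_distrib]
    have e1 : ∑ a : I × J, ∑ b : I × J, (if a = b then v a.1 a.2 * v b.1 b.2 else 0)
        = ∑ i, ∑ j, v i j ^ 2 := by
      simp [Fintype.sum_prod_type, sq]
    have e2 : ∑ a : I × J, ∑ b : I × J, (if a.2 = b.2 then v a.1 a.2 * v b.1 b.2 else 0)
        = ∑ j, (∑ i, v i j) ^ 2 := by
      simp only [Fintype.sum_prod_type, Finset.sum_ite_eq, Finset.mem_univ, if_true]
      rw [Finset.sum_comm]
      simp_rw [sq, Finset.sum_mul, Finset.mul_sum]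
    rw [e1, e2]
    have e3 : ∑ i, ∑ j, v i j ^ 2 ≤ ∑ i, w i ^ 2 := by
      refine Finset.sum_le_sum fun i _ => ?_
      simp_rw [hv, mul_pow, ← Finset.mul_sum]
      exact mul_le_of_le_one_right (sq_nonneg _) (hgrad _)
    have e4 : 0 ≤ ∑ j, (∑ i, v i j) ^ 2 := by positivity
    linarith
  have hB1 : ∀ ξ : Option I × J → ℝ, F (fun a => ∑ k, B a k * ξ k) = 1 := by
    intro ξ
    simp [hF, hB, ← Finset.sum_mul, hw]
  have hA1 : ∫ ξ, F (fun a => ∑ k, A a k * ξ k) ∂(stdPi (Option I × J))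
      = ∏ i, ∫ x, Real.exp (w i * f x) ∂(stdPi J) := by
    have hinj : Function.Injective (fun a : I × J => ((some a.1, a.2) : Option I × J)) := by
      rintro ⟨i, j⟩ ⟨i', j'⟩ h
      simpa using h
    have mp := measurePreserving_comp_injective hinj
    have hme := h.meas
    rw [← integral_prod_slices (fun i x => Real.exp (w i * f x)), ← mp.map_eq,
      integral_map mp.measurable.aemeasurable
        (Finset.measurable_prod _ fun i _ => by fun_prop).aestronglyMeasurable]
    congr 1
    ext ξ
    simp [hF, hA, Real.exp_sum]
  rw [hA1] at main
  simpa [hB1] using main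

lemma exp_integral_le {Ω : Type*} [MeasurableSpace Ω] {μ : Measure Ω} [IsProbabilityMeasure μ]
    {Y : Ω → ℝ} (hY : Integrable Y μ) (hE : Integrable (fun ω => Real.exp (Y ω)) μ) :
    Real.exp (∫ ω, Y ω ∂μ) ≤ ∫ ω, Real.exp (Y ω) ∂μ :=
  convexOn_exp.map_integral_le Real.continuous_exp.continuousOn isClosed_univ
    (ae_of_all _ fun _ => Set.mem_univ _) hY hE

/-- Gaussian concentration for the smoothed Euclidean norm. -/
lemma integral_exp_softNorm_le {J : Type*} [Fintype J] {ε : ℝ} (hε : 0 < ε) (t : ℝ) :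
    ∫ x, Real.exp (t * softNorm ε x) ∂(stdPi J)
      ≤ Real.exp (t ^ 2 / 2 + t * ∫ x, softNorm ε x ∂(stdPi J)) := by
  classical
  set m := ∫ x, softNorm ε x ∂(stdPi J) with hm
  have hC := boundedC2_softNorm (J := J) hε
  have key : ∀ r : ℕ, ∫ x, Real.exp (t * softNorm ε x) ∂(stdPi J)
      ≤ Real.exp ((t ^ 2 + t ^ 2 * (1 / ((r : ℝ) + 1))) / 2 + t * m) := by
    intro r
    have hr : (0 : ℝ) < r + 1 := by positivity
    have h := prod_integral_exp_softNorm_le (J := J) hε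
      (fun i : Option (Fin (r + 1)) => i.elim t fun _ => -(t / (r + 1)))
      (by simp [Fintype.sum_option]; field_simp; ring)
    simp only [Fintype.prod_option, Fintype.sum_option, Option.elim, Finset.prod_const,
      Finset.sum_const, Finset.card_univ, Fintype.card_fin, nsmul_eq_mul] at h
    have hJ : Real.exp (-(t / (r + 1)) * m) ≤ ∫ x, Real.exp (-(t / (r + 1)) * softNorm ε x) ∂(stdPi J) := by
      rw [hm, ← integral_const_mul]
      exact exp_integral_le (hC.tame.integrable.const_mul _) (hC.tame_exp _).integrable
    have hp := pow_le_pow_left₀ (Real.exp_pos _).le hJ (r + 1)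
    rw [← Real.exp_nat_mul] at hp
    have e : ((r + 1 : ℕ) : ℝ) * (-(t / (r + 1)) * m) = -(t * m) := by
      push_cast; field_simp
    rw [e] at hp
    have h0 : 0 ≤ ∫ x, Real.exp (t * softNorm ε x) ∂(stdPi J) :=
      integral_nonneg fun x => (Real.exp_pos _).le
    have h2 := (mul_le_mul_of_nonneg_left hp h0).trans h
    have e2 : (t ^ 2 + ((r + 1 : ℕ) : ℝ) * (-(t / (r + 1))) ^ 2) / 2
        = (t ^ 2 + t ^ 2 * (1 / ((r : ℝ) + 1))) / 2 := by
      push_cast; field_simp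
    rw [e2] at h2
    rw [Real.exp_add]
    calc _ = (∫ x, Real.exp (t * softNorm ε x) ∂(stdPi J)) * Real.exp (-(t * m)) * Real.exp (t * m) := by
          rw [mul_assoc, ← Real.exp_add]; simp
      _ ≤ _ := by gcongr
  refine ge_of_tendsto' (x := Filter.atTop) ?_ key
  refine (Real.continuous_exp.tendsto _).comp (Filter.Tendsto.add_const _ ?_)
  have := (tendsto_one_div_add_atTop_nhds_zero_nat (𝕜 := ℝ)).const_mul (t ^ 2)
  simpa using (this.const_add (t ^ 2)).div_const 2

lemma stdPi_eq_withDensity (κ : Type*) [Fintype κ] :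
    stdPi κ = (volume : Measure (κ → ℝ)).withDensity
      fun x => ENNReal.ofReal (∏ k, gaussianPDFReal 0 1 (x k)) := by
  refine Measure.pi_eq fun s hs => ?_
  have h1 : (volume : Measure (κ → ℝ)).restrict (Set.univ.pi s)
      = Measure.pi fun k => (volume : Measure ℝ).restrict (s k) := by
    rw [volume_pi, Measure.restrict_pi_pi]
  rw [withDensity_apply _ (MeasurableSet.univ_pi hs), h1, ← ofReal_integral_eq_lintegral_ofReal]
  · rw [integral_fintype_prod_eq_prod, ENNReal.ofReal_prod_of_nonneg]
    · simp_rw [gaussianReal_apply_eq_integral 0 one_ne_zero]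
    · exact fun k _ => integral_nonneg fun x => gaussianPDFReal_nonneg _ _ _
  · exact Integrable.fintype_prod (f := fun _ t => gaussianPDFReal 0 1 t) fun _ =>
      (integrable_gaussianPDFReal 0 1).restrict
  · exact ae_of_all _ fun x => Finset.prod_nonneg fun k _ => gaussianPDFReal_nonneg _ _ _

lemma exists_integral_softNorm_zero_eq (k : ℕ) :
    ∃ c : ℝ, ∀ φ : ℝ → ℝ, ∫ x, φ (softNorm 0 x) ∂(stdPi (Fin (k + 1)))
      = c * ∫ r in Set.Ioi (0 : ℝ), r ^ k * (φ r * Real.exp (-(1 / 2) * r ^ 2)) := by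
  refine ⟨((Real.sqrt (2 * Real.pi))⁻¹) ^ (k + 1) * (((k + 1 : ℕ) : ℝ) *
    (volume : Measure (EuclideanSpace ℝ (Fin (k + 1)))).real (Metric.ball 0 1)), fun φ => ?_⟩
  have h1 : ∀ x : Fin (k + 1) → ℝ, ∏ i, gaussianPDFReal 0 1 (x i)
      = ((Real.sqrt (2 * Real.pi))⁻¹) ^ (k + 1) * Real.exp (-(1 / 2) * softNorm 0 x ^ 2) := by
    intro x
    simp only [gaussianPDFReal_def, Finset.prod_mul_distrib, ← Real.exp_sum, softNorm_sq]
    simp [← Finset.sum_div, Finset.sum_neg_distrib]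
    left
    ring_nf
  have h2 : Measurable fun x : Fin (k + 1) → ℝ =>
      ENNReal.ofReal (∏ i, gaussianPDFReal 0 1 (x i)) := by
    simp_rw [h1]; fun_prop
  rw [stdPi_eq_withDensity, integral_withDensity_eq_integral_toReal_smul h2
    (ae_of_all _ fun _ => ENNReal.ofReal_lt_top)]
  have h3 : ∀ x : Fin (k + 1) → ℝ,
      (ENNReal.ofReal (∏ i, gaussianPDFReal 0 1 (x i))).toReal • φ (softNorm 0 x)
      = ((Real.sqrt (2 * Real.pi))⁻¹) ^ (k + 1) *
        (φ (softNorm 0 x) * Real.exp (-(1 / 2) * softNorm 0 x ^ 2)) := by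
    intro x
    rw [ENNReal.toReal_ofReal (Finset.prod_nonneg fun k _ => gaussianPDFReal_nonneg _ _ _), h1,
      smul_eq_mul]
    ring
  simp_rw [h3]
  rw [integral_const_mul, mul_assoc]
  congr 1
  have h4 := integral_fun_norm_addHaar (volume : Measure (EuclideanSpace ℝ (Fin (k + 1))))
    (fun r : ℝ => φ r * Real.exp (-(1 / 2) * r ^ 2))
  rw [← (PiLp.volume_preserving_ofLp (Fin (k + 1))).integral_comp
    (MeasurableEquiv.toLp 2 _).symm.measurableEmbedding]
  simp only [finrank_euclideanSpace, Fintype.card_fin, Nat.add_sub_cancel, smul_eq_mul,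
    nsmul_eq_mul] at h4
  rw [mul_assoc, ← h4]
  refine integral_congr_ae (ae_of_all _ fun x => ?_)
  have : softNorm 0 x.ofLp = ‖x‖ := by
    simp [softNorm, EuclideanSpace.norm_eq]
  simp [this]

/-- The mean of the Euclidean norm of a standard Gaussian vector in dimension `k`. -/
noncomputable def chiMean (k : ℕ) : ℝ := ∫ x, softNorm 0 x ∂(stdPi (Fin k))

lemma integral_Ioi_pow_mul_exp (k : ℕ) :
    ∫ r in Set.Ioi (0 : ℝ), r ^ k * Real.exp (-(1 / 2) * r ^ 2)
      = (1 / 2 : ℝ) ^ (-((k : ℝ) + 1) / 2) * (1 / 2) * Real.Gamma (((k : ℝ) + 1) / 2) := by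
  have := integral_rpow_mul_exp_neg_mul_rpow (p := 2) (q := k) (b := 1 / 2) two_pos
    (by linarith [(Nat.cast_nonneg k : (0 : ℝ) ≤ k)]) (by norm_num)
  rw [← this]
  simp

lemma chiMean_succ (k : ℕ) : chiMean (k + 1)
    = Real.sqrt 2 * Real.Gamma ((k : ℝ) / 2 + 1) / Real.Gamma (((k : ℝ) + 1) / 2) := by
  obtain ⟨c, hc⟩ := exists_integral_softNorm_zero_eq k
  have h0 := hc fun _ => 1
  have h1 := hc fun r => r
  have e : ∀ r : ℝ, r ^ k * (r * Real.exp (-(1 / 2) * r ^ 2))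
      = r ^ (k + 1) * Real.exp (-(1 / 2) * r ^ 2) := fun r => by ring
  simp_rw [e, integral_Ioi_pow_mul_exp] at h1
  simp_rw [one_mul, integral_Ioi_pow_mul_exp] at h0
  simp only [integral_const, probReal_univ, smul_eq_mul, mul_one] at h0
  rw [chiMean, h1]
  have hG : 0 < Real.Gamma (((k : ℝ) + 1) / 2) := Real.Gamma_pos_of_pos (by positivity)
  have e2 : (1 / 2 : ℝ) ^ (-(((k + 1 : ℕ) : ℝ) + 1) / 2)
      = Real.sqrt 2 * (1 / 2 : ℝ) ^ (-((k : ℝ) + 1) / 2) := by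
    rw [Real.sqrt_eq_rpow, one_div, Real.inv_rpow two_pos.le, Real.inv_rpow two_pos.le,
      ← Real.rpow_neg two_pos.le, ← Real.rpow_neg two_pos.le, ← Real.rpow_add two_pos]
    congr 1; push_cast; ring
  have e3 : (((k + 1 : ℕ) : ℝ) + 1) / 2 = (k : ℝ) / 2 + 1 := by push_cast; ring
  rw [e2, e3, eq_div_iff hG.ne']
  calc _ = (Real.sqrt 2 * Real.Gamma ((k : ℝ) / 2 + 1)) * (c * ((1 / 2 : ℝ) ^ (-((k : ℝ) + 1) / 2) *
      (1 / 2) * Real.Gamma (((k : ℝ) + 1) / 2))) := by ring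
    _ = _ := by rw [← h0, mul_one]

lemma chiMean_pos {k : ℕ} (hk : 0 < k) : 0 < chiMean k := by
  obtain ⟨k, rfl⟩ := Nat.exists_eq_succ_of_ne_zero hk.ne'
  rw [Nat.succ_eq_add_one, chiMean_succ]
  have h1 : 0 < Real.Gamma (((k : ℝ) + 1) / 2) := Real.Gamma_pos_of_pos (by positivity)
  have h2 : 0 < Real.Gamma ((k : ℝ) / 2 + 1) := Real.Gamma_pos_of_pos (by positivity)
  positivity

lemma chiMean_mul_chiMean_succ {k : ℕ} (hk : 0 < k) : chiMean k * chiMean (k + 1) = k := by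
  obtain ⟨k, rfl⟩ := Nat.exists_eq_succ_of_ne_zero hk.ne'
  rw [Nat.succ_eq_add_one, chiMean_succ, chiMean_succ]
  have h1 : 0 < Real.Gamma (((k : ℝ) + 1) / 2) := Real.Gamma_pos_of_pos (by positivity)
  have h2 : 0 < Real.Gamma ((k : ℝ) / 2 + 1) := Real.Gamma_pos_of_pos (by positivity)
  have e1 : (((k + 1 : ℕ) : ℝ) + 1) / 2 = (k : ℝ) / 2 + 1 := by push_cast; ring
  have e2 : Real.Gamma (((k + 1 : ℕ) : ℝ) / 2 + 1)
      = ((k : ℝ) + 1) / 2 * Real.Gamma (((k : ℝ) + 1) / 2) := by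
    push_cast
    exact Real.Gamma_add_one (by positivity)
  rw [e1, e2]
  field_simp
  rw [Real.sq_sqrt zero_le_two]
  push_cast
  ring

lemma chiMean_sq_le {k : ℕ} (hk : 0 < k) : chiMean k ^ 2 ≤ k := by
  obtain ⟨k, rfl⟩ := Nat.exists_eq_succ_of_ne_zero hk.ne'
  rw [Nat.succ_eq_add_one, chiMean_succ]
  have h1 : 0 < Real.Gamma (((k : ℝ) + 1) / 2) := Real.Gamma_pos_of_pos (by positivity)
  have h2 : 0 < Real.Gamma ((k : ℝ) / 2 + 1) := Real.Gamma_pos_of_pos (by positivity)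
  have h := Real.Gamma_mul_add_mul_le_rpow_Gamma_mul_rpow_Gamma (s := ((k : ℝ) + 1) / 2)
    (t := ((k : ℝ) + 1) / 2 + 1) (a := 1 / 2) (b := 1 / 2) (by positivity) (by positivity)
    (by norm_num) (by norm_num) (by norm_num)
  rw [Real.Gamma_add_one (by positivity), ← Real.sqrt_eq_rpow, ← Real.sqrt_eq_rpow,
    ← Real.sqrt_mul h1.le] at h
  have h' := pow_le_pow_left₀ (Real.Gamma_pos_of_pos (by positivity)).le h 2
  rw [Real.sq_sqrt (by positivity)] at h'
  have e : (1 : ℝ) / 2 * (((k : ℝ) + 1) / 2) + 1 / 2 * (((k : ℝ) + 1) / 2 + 1) = (k : ℝ) / 2 + 1 := by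
    ring
  rw [e] at h'
  rw [div_pow, mul_pow, Real.sq_sqrt zero_le_two, div_le_iff₀ (by positivity)]
  push_cast
  nlinarith

lemma chiMean_add_two {k : ℕ} (hk : 0 < k) :
    chiMean (k + 2) ^ 2 * (k : ℝ) ^ 2 = chiMean k ^ 2 * ((k : ℝ) + 1) ^ 2 := by
  have h1 := chiMean_mul_chiMean_succ hk
  have h2 := chiMean_mul_chiMean_succ (Nat.succ_pos k)
  rw [Nat.succ_eq_add_one, add_assoc, one_add_one_eq_two] at h2
  push_cast at h2
  have h4 : chiMean k * ((k : ℝ) + 1) = chiMean (k + 2) * k := by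
    linear_combination chiMean (k + 2) * h1 - chiMean k * h2
  rw [← mul_pow, ← mul_pow, h4]

lemma chiMean_sq_le_refined {k : ℕ} (hk : 0 < k) :
    chiMean k ^ 2 ≤ k - 1 / 2 + 1 / (7 * k) := by
  set β : ℕ → ℝ := fun k => k - 1 / 2 + 1 / (7 * k) with hβ
  have hlow : ∀ {k : ℕ}, 0 < k → (k : ℝ) - 1 / 2 ≤ β k := by
    intro k hk
    have : (0 : ℝ) < k := by exact_mod_cast hk
    simp only [hβ, le_add_iff_nonneg_right]
    positivity
  have hpos : ∀ {k : ℕ}, 0 < k → 0 < β k := by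
    intro k hk
    have : (1 : ℝ) ≤ k := by exact_mod_cast hk
    linarith [hlow hk]
  have hstep : ∀ {k : ℕ}, 0 < k → chiMean k ^ 2 / β k ≤ chiMean (k + 2) ^ 2 / β (k + 2) := by
    intro k hk
    have hk0 : (0 : ℝ) < k := by exact_mod_cast hk
    rw [div_le_div_iff₀ (hpos hk) (hpos (by omega))]
    have h1 := chiMean_add_two hk
    have h2 : β (k + 2) * (k : ℝ) ^ 2 ≤ β k * ((k : ℝ) + 1) ^ 2 := by
      have e : β k * ((k : ℝ) + 1) ^ 2 - β (k + 2) * (k : ℝ) ^ 2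
          = ((k : ℝ) - 2) ^ 2 / (14 * k * (k + 2)) := by
        simp only [hβ]
        push_cast
        field_simp
        ring
      have : 0 ≤ ((k : ℝ) - 2) ^ 2 / (14 * k * (k + 2)) := by positivity
      linarith
    have h3 : 0 < (k : ℝ) ^ 2 := by positivity
    refine le_of_mul_le_mul_right ?_ h3
    calc chiMean k ^ 2 * β (k + 2) * (k : ℝ) ^ 2 = chiMean k ^ 2 * (β (k + 2) * (k : ℝ) ^ 2) := by ring
      _ ≤ chiMean k ^ 2 * (β k * ((k : ℝ) + 1) ^ 2) := by gcongr
      _ = (chiMean k ^ 2 * ((k : ℝ) + 1) ^ 2) * β k := by ring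
      _ = _ := by rw [← h1]; ring
  have hmono : ∀ j : ℕ, chiMean k ^ 2 / β k ≤ chiMean (k + 2 * j) ^ 2 / β (k + 2 * j) := by
    intro j
    induction j with
    | zero => simp
    | succ j ih => exact ih.trans (hstep (by omega))
  have hle : ∀ j : ℕ, chiMean k ^ 2 / β k ≤ 1 + 1 / ((j : ℝ) + 1) := by
    intro j
    refine (hmono j).trans ?_
    have hK : 0 < k + 2 * j := by omega
    have h1 : (1 : ℝ) ≤ k := by exact_mod_cast hk
    have hj : (0 : ℝ) ≤ j := Nat.cast_nonneg j
    have h2 := hlow hK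
    rw [div_le_iff₀ (hpos hK)]
    have h3 := chiMean_sq_le hK
    have h4 : (1 : ℝ) / 2 ≤ 1 / ((j : ℝ) + 1) * β (k + 2 * j) := by
      rw [one_div_mul_eq_div, le_div_iff₀ (by positivity)]
      push_cast at h2
      linarith
    push_cast at h2 h3
    linarith
  have hlim : chiMean k ^ 2 / β k ≤ 1 := by
    refine ge_of_tendsto' (x := Filter.atTop) ?_ hle
    simpa using (tendsto_one_div_add_atTop_nhds_zero_nat (𝕜 := ℝ)).const_add 1
  rw [div_le_iff₀ (hpos hk), one_mul] at hlim
  exact hlim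

lemma sqrt_succ_sub_sqrt_le_chiMean_sub {k : ℕ} (hk : 0 < k) :
    Real.sqrt ((k + 1 : ℕ) : ℝ) - Real.sqrt k ≤ chiMean (k + 1) - chiMean k := by
  have hk1 : (1 : ℝ) ≤ k := by exact_mod_cast hk
  have hk0 : (0 : ℝ) < k := by linarith
  push_cast
  set x : ℝ := (k : ℝ)
  set a := Real.sqrt (x + 1)
  set b := Real.sqrt x
  have ha : a ^ 2 = x + 1 := Real.sq_sqrt (by linarith)
  have hb : b ^ 2 = x := Real.sq_sqrt hk0.le
  have ha0 : 0 < a := Real.sqrt_pos.2 (by linarith)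
  have hb0 : 0 < b := Real.sqrt_pos.2 hk0
  set m := chiMean k
  have hm : 0 < m := chiMean_pos hk
  have hmul : m * chiMean (k + 1) = x := chiMean_mul_chiMean_succ hk
  set β := x - 1 / 2 + 1 / (7 * x) with hβ
  have hmβ : m ^ 2 ≤ β := chiMean_sq_le_refined hk
  have hβ0 : 0 ≤ β := (sq_nonneg m).trans hmβ
  have hab : x + 1 / 2 - 1 / (8 * x) ≤ a * b := by
    refine (abs_le_of_sq_le_sq' ?_ (by positivity)).2
    rw [mul_pow, ha, hb]
    have e : (x + 1) * x - (x + 1 / 2 - 1 / (8 * x)) ^ 2 = (8 * x - 1) / (64 * x ^ 2) := by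
      field_simp
      ring
    have : 0 ≤ (8 * x - 1) / (64 * x ^ 2) := div_nonneg (by linarith) (by positivity)
    linarith
  have hD : 4 * x + 2 - 1 / (4 * x) ≤ (a + b) ^ 2 := by
    have : 1 / (4 * x) = 2 * (1 / (8 * x)) := by field_simp; norm_num
    nlinarith
  have hkey : β ≤ ((x - β) * (a + b)) ^ 2 := by
    rw [mul_pow]
    refine le_trans ?_ (mul_le_mul_of_nonneg_left hD (sq_nonneg _))
    obtain ⟨y, hy⟩ : ∃ y, y = 1 / x := ⟨_, rfl⟩
    have hxy : x * y = 1 := by rw [hy]; field_simp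
    have hy0 : 0 < y := by rw [hy]; positivity
    have hy1 : y ≤ 1 := by nlinarith
    have e1 : 1 / (7 * x) = y / 7 := by rw [hy]; field_simp
    have e2 : 1 / (4 * x) = y / 4 := by rw [hy]; field_simp
    rw [hβ, e1, e2]
    have e3 : (x - (x - 1 / 2 + y / 7)) ^ 2 * (4 * x + 2 - y / 4) - (x - 1 / 2 + y / 7)
        = 3 / 7 - 321 / 784 * y + 15 / 196 * y ^ 2 - y ^ 3 / 196 := by
      linear_combination (-4 / 7 + 4 / 49 * y) * hxy
    nlinarith [mul_nonneg (sq_nonneg y) (sub_nonneg.2 hy1)]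
  have hxβ : 0 ≤ x - β := by
    have : 1 / (7 * x) ≤ 1 / 7 := by
      apply one_div_le_one_div_of_le <;> linarith
    rw [hβ]; linarith
  have hms : m ≤ (x - β) * (a + b) :=
    (abs_le_of_sq_le_sq' (hmβ.trans hkey) (by positivity)).2
  have hd : (a - b) * (a + b) = 1 := by ring_nf; rw [ha, hb]; ring
  have hd0 : 0 < a - b := by
    by_contra h
    nlinarith
  have h5 : (a - b) * m ≤ x - β := by
    calc (a - b) * m ≤ (a - b) * ((x - β) * (a + b)) := by gcongr
      _ = (x - β) * ((a - b) * (a + b)) := by ring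
      _ = _ := by rw [hd, mul_one]
  refine le_of_mul_le_mul_left ?_ hm
  nlinarith

/-- The mean of the norm of a Gaussian vector grows at least as fast as the square root of the
dimension. -/
lemma sqrt_sub_sqrt_le_chiMean_sub {n N : ℕ} (hn : 0 < n) (h : n ≤ N) :
    Real.sqrt N - Real.sqrt n ≤ chiMean N - chiMean n := by
  induction N, h using Nat.le_induction with
  | base => simp
  | succ N hN ih => linarith [sqrt_succ_sub_sqrt_le_chiMean_sub (hn.trans_le hN)]

/-- The smoothed minimum over `u : U` of `f (x (u, ·))`, in exponential form. -/
noncomputable def softMinExp {U O : Type*} [Fintype U] (K p : ℝ) (f : (O → ℝ) → ℝ)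
    (x : U × O → ℝ) : ℝ :=
  Real.exp (p * Real.log (∑ u, Real.exp (-K * f fun o => x (u, o))))

lemma BoundedC2.tame_softMinExp {U O : Type*} [Fintype U] [Nonempty U] [Fintype O]
    {f : (O → ℝ) → ℝ} {f1 : O → (O → ℝ) → ℝ} {f2 : O → O → (O → ℝ) → ℝ} (h : BoundedC2 f f1 f2)
    {K p : ℝ} (hK : 0 < K) (hp0 : 0 < p) : Tame (softMinExp (U := U) K p f) := by
  have hfm := h.meas
  have hSpos : ∀ x : U × O → ℝ, 0 < ∑ u, Real.exp (-K * f fun o => x (u, o)) := fun x =>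
    Finset.sum_pos (fun u _ => Real.exp_pos _) Finset.univ_nonempty
  obtain ⟨C, c, hC, hc, hb⟩ := h.bound
  refine Tame.exp_of_le (by fun_prop) (p * (Real.log (Fintype.card U) + K * C)) (p * (K * c))
    (by positivity) fun x => ?_
  rw [mul_assoc, ← mul_add]
  refine mul_le_mul_of_nonneg_left ?_ hp0.le
  rw [Real.log_le_iff_le_exp (hSpos x), add_assoc, Real.exp_add, Real.exp_log (by
    exact_mod_cast Fintype.card_pos)]
  refine (Finset.sum_le_card_nsmul _ _ (Real.exp (K * C + K * c * ∑ a, |x a|))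
    fun u _ => Real.exp_le_exp.2 ?_).trans (by simp)
  have hs : ∑ o, |x (u, o)| ≤ ∑ a, |x a| := by
    rw [Fintype.sum_prod_type]
    exact Finset.single_le_sum (f := fun i => ∑ j, |x (i, j)|) (fun _ _ => by positivity)
      (Finset.mem_univ u)
  have h1 := (neg_abs_le (f fun o => x (u, o)))
  have h2 := hb fun o => x (u, o)
  have h3 := mul_le_mul_of_nonneg_left hs hc
  nlinarith

/-- Gordon's comparison inequality for a smoothed min-max of a Gaussian process. -/
lemma integral_softMinExp_le {U J κ : Type*} [Fintype U] [Nonempty U] [Fintype J] [DecidableEq J]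
    [Fintype κ] {f : (Option J → ℝ) → ℝ} {f1 : Option J → (Option J → ℝ) → ℝ}
    {f2 : Option J → Option J → (Option J → ℝ) → ℝ} (h : BoundedC2 f f1 f2)
    (hnone : ∀ x, f1 none x = 1) (hgrad : ∀ x, ∑ j, f1 (some j) x ^ 2 ≤ 1)
    {K p : ℝ} (hK : 0 < K) (hp0 : 0 < p) (hp1 : p ≤ 1) (A B : U × Option J → κ → ℝ)
    (hAB : ∀ a b, ∑ k, A a k * B b k = 0) (T : U → U → ℝ) (hT : ∀ u v, T u v ≤ 1)
    (hTd : ∀ u, T u u = 1)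
    (hsome : ∀ u i v j, ∑ k, A (u, some i) k * A (v, some j) k
      - ∑ k, B (u, some i) k * B (v, some j) k = if i = j then T u v - 1 else 0)
    (hnn : ∀ u v, ∑ k, A (u, none) k * A (v, none) k
      - ∑ k, B (u, none) k * B (v, none) k = 1 - T u v)
    (hns : ∀ u v j, ∑ k, A (u, none) k * A (v, some j) k
      - ∑ k, B (u, none) k * B (v, some j) k = 0) :
    ∫ ξ, softMinExp K p f (fun a => ∑ k, A a k * ξ k) ∂(stdPi κ)
      ≤ ∫ ξ, softMinExp K p f (fun a => ∑ k, B a k * ξ k) ∂(stdPi κ) := by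
  classical
  have hfm := h.meas
  set S : (U × Option J → ℝ) → ℝ := fun x => ∑ u, Real.exp (-K * f fun o => x (u, o)) with hS
  have hSpos : ∀ x, 0 < S x := fun x =>
    Finset.sum_pos (fun u _ => Real.exp_pos _) Finset.univ_nonempty
  have hSm : Measurable S := by fun_prop
  set π : U → (U × Option J → ℝ) → ℝ := fun u x =>
    Real.exp (-K * f (fun o => x (u, o)) + -1 * Real.log (S x)) with hπ
  have hπ' : ∀ u x, π u x = (S x)⁻¹ * Real.exp (-K * f fun o => x (u, o)) := by
    intro u x
    simp only [hπ, Real.exp_add, neg_one_mul, Real.exp_neg (Real.log _), Real.exp_log (hSpos x)]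
    ring
  have hπ1 : ∀ u x, |π u x| ≤ 1 := by
    intro u x
    rw [hπ', abs_of_nonneg (mul_pos (inv_pos.2 (hSpos x)) (Real.exp_pos _)).le, inv_mul_le_iff₀ (hSpos x), mul_one]
    exact Finset.single_le_sum (f := fun u => Real.exp (-K * f fun o => x (u, o)))
      (fun _ _ => (Real.exp_pos _).le) (Finset.mem_univ u)
  have hπm : ∀ u, Measurable (π u) := fun u => by fun_prop
  set F : (U × Option J → ℝ) → ℝ := softMinExp K p f with hF
  set F1 : U × Option J → (U × Option J → ℝ) → ℝ := fun a x =>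
    F x * (-(p * K) * (π a.1 x * f1 a.2 fun o => x (a.1, o))) with hF1
  set π1 : U → U × Option J → (U × Option J → ℝ) → ℝ := fun u b x =>
    π u x * (-K * (if b.1 = u then f1 b.2 fun o => x (u, o) else 0)
      + K * (π b.1 x * f1 b.2 fun o => x (b.1, o))) with hπ1def
  set F2 : U × Option J → U × Option J → (U × Option J → ℝ) → ℝ := fun a b x =>
    F1 b x * (-(p * K) * (π a.1 x * f1 a.2 fun o => x (a.1, o)))
      + F x * (-(p * K) * (π1 a.1 b x * f1 a.2 (fun o => x (a.1, o))
        + π a.1 x * if b.1 = a.1 then f2 a.2 b.2 (fun o => x (a.1, o)) else 0)) with hF2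
  have pS : HasPartials S fun b x =>
      Real.exp (-K * f fun o => x (b.1, o)) * (-K * f1 b.2 fun o => x (b.1, o)) := by
    refine (HasPartials.sum Finset.univ fun u =>
      ((h.part1.slice u).const_mul (-K)).exp).congr fun b x => ?_
    simp
  have plog : HasPartials (fun x => Real.log (S x)) fun b x =>
      -K * (π b.1 x * f1 b.2 fun o => x (b.1, o)) := by
    refine (pS.log fun x => (hSpos x).ne').congr fun b x => ?_
    rw [hπ']; ring
  have p1 : HasPartials F F1 := by
    refine (plog.const_mul p).exp.congr fun b x => ?_
    simp only [hF1, hF, softMinExp, hS]; ring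
  have pπ : ∀ u, HasPartials (π u) (π1 u) := fun u =>
    (((h.part1.slice u).const_mul (-K)).add (plog.const_mul (-1))).exp.congr fun b x => by
      simp only [hπ1def, hπ]; ring
  have p2 : ∀ a, HasPartials (F1 a) (F2 a) := fun a =>
    p1.mul (((pπ a.1).mul ((h.part2 a.2).slice a.1)).const_mul (-(p * K)))
  have tF : Tame F := h.tame_softMinExp hK hp0
  have tπ : ∀ u, Tame (π u) := fun u => Tame.of_bounded (hπm u) 1 (hπ1 u)
  have tf1 : ∀ u o, Tame (fun x : U × Option J → ℝ => f1 o fun o => x (u, o)) := fun u o =>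
    (h.tame1 o).slice u
  have tF1 : ∀ a, Tame (F1 a) := fun a =>
    tF.mul ((Tame.const _).mul ((tπ a.1).mul (tf1 a.1 a.2)))
  have tite : ∀ (q : Prop) [Decidable q] {g : (U × Option J → ℝ) → ℝ}, Tame g →
      Tame fun x => if q then g x else 0 := by
    intro q _ g hg
    split_ifs
    · exact hg
    · exact Tame.const 0
  have tπ1 : ∀ u b, Tame (π1 u b) := fun u b =>
    (tπ u).mul (((Tame.const _).mul (tite _ (tf1 u b.2))).add
      ((Tame.const _).mul ((tπ b.1).mul (tf1 b.1 b.2))))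
  have tF2 : ∀ a b, Tame (F2 a b) := fun a b =>
    ((tF1 b).mul ((Tame.const _).mul ((tπ a.1).mul (tf1 a.1 a.2)))).add
      (tF.mul ((Tame.const _).mul (((tπ1 a.1 b).mul (tf1 a.1 a.2)).add
        ((tπ a.1).mul (tite _ ((h.tame2 a.2 b.2).slice a.1))))))
  have main := gaussian_comparison A B hAB tF tF1 tF2 p1 p2 0 fun x => by
    rw [zero_mul]
    set D : U × Option J → U × Option J → ℝ := fun a b =>
      ∑ k, A a k * A b k - ∑ k, B a k * B b k with hD
    set v : U → Option J → ℝ := fun u o => f1 o fun o => x (u, o) with hv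
    have hsn : ∀ u v j, D (v, some j) (u, none) = 0 := by
      intro u v j
      rw [← hns u v j]
      simp only [hD, mul_comm]
    have hDd : ∀ u o o', D (u, o) (u, o') = 0 := by
      rintro u (_ | i) (_ | j)
      · simp [hD, hnn, hTd]
      · exact hns _ _ _
      · exact hsn _ _ _
      · simp [hD, hsome, hTd]
    have e : ∀ a b, D a b * F2 a b x
        = F x * (p * K ^ 2 * (p - 1)) * (π a.1 x * π b.1 x * (D a b * (v a.1 a.2 * v b.1 b.2))) := by
      rintro ⟨u, o⟩ ⟨u', o'⟩
      by_cases huu : u' = u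
      · subst huu; simp [hDd]
      · simp only [hF2, hF1, hπ1def, huu, if_false, hv]
        ring
    have e2 : ∀ u u', ∑ o, ∑ o', D (u, o) (u', o') * (v u o * v u' o')
        = (1 - T u u') * (1 - ∑ j, v u (some j) * v u' (some j)) := by
      intro u u'
      simp only [Fintype.sum_option, hsn, zero_mul]
      simp only [hD, hns, hnn, hsome, zero_mul, hv, hnone, ite_mul, Finset.sum_ite_eq,
        Finset.mem_univ, if_true, Finset.sum_const_zero, mul_sub, Finset.mul_sum]
      simp only [mul_one, add_zero, zero_add, sub_eq_add_neg, ← Finset.sum_neg_distrib]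
      congr 1
      refine Finset.sum_congr rfl fun j _ => by ring
    have e3 : ∑ a, ∑ b, D a b * F2 a b x = F x * (p * K ^ 2 * (p - 1)) * ∑ u, ∑ u',
        π u x * π u' x * ((1 - T u u') * (1 - ∑ j, v u (some j) * v u' (some j))) := by
      simp_rw [e, ← e2, Fintype.sum_prod_type, Finset.mul_sum]
      refine Finset.sum_congr rfl fun u _ => ?_
      rw [Finset.sum_comm]
    rw [e3]
    refine mul_nonpos_of_nonpos_of_nonneg ?_ ?_
    · refine mul_nonpos_of_nonneg_of_nonpos (Real.exp_pos _).le ?_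
      exact mul_nonpos_of_nonneg_of_nonpos (by positivity) (by linarith)
    · refine Finset.sum_nonneg fun u _ => Finset.sum_nonneg fun u' _ => ?_
      refine mul_nonneg (mul_nonneg (Real.exp_pos _).le (Real.exp_pos _).le)
        (mul_nonneg (sub_nonneg.2 (hT _ _)) (sub_nonneg.2 ?_))
      have h1 := hgrad fun o => x (u, o)
      have h2 := hgrad fun o => x (u', o)
      have h3 : ∑ j, v u (some j) * v u' (some j)
          ≤ ∑ j, (v u (some j) ^ 2 + v u' (some j) ^ 2) / 2 :=
        Finset.sum_le_sum fun j _ => by nlinarith [sq_nonneg (v u (some j) - v u' (some j))]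
      rw [← Finset.sum_div, Finset.sum_add_distrib] at h3
      simp only [hv] at h3 ⊢
      linarith
  simpa using main

/-- Disjoint blocks of coordinates are independent under the standard Gaussian measure. -/
lemma integral_mul_of_disjoint_coords {κ κ₁ κ₂ : Type*} [Fintype κ] [Fintype κ₁] [Fintype κ₂]
    {e₁ : κ₁ → κ} {e₂ : κ₂ → κ} (he : Function.Injective (Sum.elim e₁ e₂))
    {a : (κ₁ → ℝ) → ℝ} {b : (κ₂ → ℝ) → ℝ} (ha : Measurable a) (hb : Measurable b) :
    ∫ ξ, a (fun k => ξ (e₁ k)) * b (fun k => ξ (e₂ k)) ∂(stdPi κ)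
      = (∫ x, a x ∂(stdPi κ₁)) * ∫ y, b y ∂(stdPi κ₂) := by
  have mp : MeasurePreserving _ (stdPi κ) ((stdPi κ₁).prod (stdPi κ₂)) :=
    (measurePreserving_sumPiEquivProdPi (X := fun _ : κ₁ ⊕ κ₂ => ℝ)
      fun _ => gaussianReal 0 1).comp (measurePreserving_comp_injective he)
  rw [← integral_prod_mul, ← mp.map_eq, integral_map mp.measurable.aemeasurable]
  · rfl
  · exact ((ha.comp measurable_fst).mul (hb.comp measurable_snd)).aestronglyMeasurable

lemma boundedC2_softNorm_add {J : Type*} [Fintype J] {ε : ℝ} (hε : 0 < ε) :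
    ∃ (f1 : Option J → (Option J → ℝ) → ℝ) (f2 : Option J → Option J → (Option J → ℝ) → ℝ),
      BoundedC2 (fun x : Option J → ℝ => softNorm ε (fun j => x (some j)) + x none) f1 f2 ∧
      (∀ x, f1 none x = 1) ∧ ∀ x, ∑ j, f1 (some j) x ^ 2 ≤ 1 := by
  classical
  obtain ⟨f2, h⟩ : ∃ f2, BoundedC2 (softNorm ε : (J → ℝ) → ℝ) _ f2 := ⟨_, boundedC2_softNorm hε⟩
  have lift : ∀ {g : (J → ℝ) → ℝ} {g1 : J → (J → ℝ) → ℝ}, HasPartials g g1 →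
      HasPartials (fun x : Option J → ℝ => g fun j => x (some j))
        (fun o x => o.elim 0 fun j => g1 j fun j => x (some j)) := by
    intro g g1 hg c c' t hc
    refine (hg (fun s j => c s (some j)) (fun j => c' (some j)) t fun j => hc (some j)).congr_deriv ?_
    simp [Fintype.sum_option]
  obtain ⟨C, hC⟩ := h.bound2
  obtain ⟨Cb, cb, hCb, hcb, hb⟩ := h.bound
  have m1 := h.meas1
  have m2 := h.meas2
  have hm : Measurable fun (x : Option J → ℝ) (j : J) => x (some j) := by fun_prop
  refine ⟨fun o x => o.elim 1 fun j => x (some j) / softNorm ε fun j => x (some j),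
    fun o o' x => o.elim 0 fun j => o'.elim 0 fun k => f2 j k fun j => x (some j), ⟨by fun_prop, ?_, ?_, ?_, ?_, ?_, ?_, ?_⟩,
    fun x => rfl, fun x => sum_sq_div_softNorm_le ε fun j => x (some j)⟩
  · rintro (_ | j)
    · exact measurable_const
    · exact (m1 j).comp hm
  · rintro (_ | j) (_ | k)
    · exact measurable_const
    · exact measurable_const
    · exact measurable_const
    · exact (m2 j k).comp hm
  · refine ((lift h.part1).add (HasPartials.coord none)).congr fun o x => ?_
    cases o <;> simp
  · rintro (_ | j)
    · exact (HasPartials.const 1)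
    · exact lift (h.part2 j)
  · rintro (_ | j) x
    · simp
    · exact h.bound1 j fun j => x (some j)
  · refine ⟨|C|, ?_⟩
    rintro (_ | j) (_ | k) x
    · simp
    · simp
    · simp
    · exact (hC j k _).trans (le_abs_self C)
  · refine ⟨Cb, cb + 1, hCb, by positivity, fun x => (abs_add_le _ _).trans ?_⟩
    rw [Fintype.sum_option]
    have := hb fun j => x (some j)
    have h3 : 0 ≤ ∑ j, |x (some j)| := by positivity
    nlinarith [mul_nonneg hcb (abs_nonneg (x none))]

section Gordon

variable {U I J : Type*} [Fintype U] [Nonempty U] [Fintype I] [Fintype J]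

lemma integrable_softNorm_zero : Integrable (softNorm 0 : (J → ℝ) → ℝ) (stdPi J) :=
  (Tame.mono (Tame.sum fun j (_ : j ∈ Finset.univ) => Tame.abs_coord j) (by fun_prop) fun x => by
    rw [abs_of_nonneg (softNorm_nonneg _ _)]
    exact (softNorm_zero_le_sum x).trans (le_abs_self _)).integrable

lemma integrable_softNorm {ε : ℝ} (hε : 0 < ε) : Integrable (softNorm ε : (J → ℝ) → ℝ) (stdPi J) := by
  classical
  exact (boundedC2_softNorm hε).tame.integrable

lemma integral_softNorm_zero_le {ε : ℝ} (hε : 0 < ε) :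
    ∫ x, softNorm 0 x ∂(stdPi J) ≤ ∫ x, softNorm ε x ∂(stdPi J) :=
  integral_mono integrable_softNorm_zero (integrable_softNorm hε) (softNorm_zero_le ε)

lemma integral_softNorm_le {ε : ℝ} (hε : 0 < ε) :
    ∫ x, softNorm ε x ∂(stdPi J) ≤ ∫ x, softNorm 0 x ∂(stdPi J) + ε := by
  have := integral_mono (integrable_softNorm (J := J) hε)
    (integrable_softNorm_zero.add (integrable_const ε)) (softNorm_le hε.le)
  rw [integral_add' integrable_softNorm_zero (integrable_const ε)] at this
  simpa using this

lemma abs_sum_mul_le_softNorm {w : I → ℝ} (hw : ∑ i, w i ^ 2 = 1) (x : I → ℝ) :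
    |∑ i, w i * x i| ≤ softNorm 0 x := by
  refine Real.abs_le_sqrt ?_
  have := Finset.sum_mul_sq_le_sq_mul_sq Finset.univ w x
  rw [hw] at this
  simpa using this

/-- The Gaussian process `u ↦ (uᵀG, γ)`. -/
noncomputable def gordonLeft (w : U → I → ℝ) [DecidableEq J] :
    U × Option J → Option I × Option J → ℝ
  | (_, none), (none, none) => 1
  | (u, some j), (some i, some j') => if j = j' then w u i else 0
  | _, _ => 0

/-- The decoupled Gaussian process `u ↦ (h, ⟨u, g⟩)`. -/
noncomputable def gordonRight (w : U → I → ℝ) [DecidableEq J] :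
    U × Option J → Option I × Option J → ℝ
  | (u, none), (some i, none) => w u i
  | (_, some j), (none, some j') => if j = j' then 1 else 0
  | _, _ => 0

lemma gordon_comparison [DecidableEq J] (w : U → I → ℝ) (hw : ∀ u, ∑ i, w u i ^ 2 = 1) {ε : ℝ}
    (hε : 0 < ε) {K p : ℝ} (hK : 0 < K) (hp0 : 0 < p) (hp1 : p ≤ 1) :
    ∫ ξ, softMinExp K p (fun x : Option J → ℝ => softNorm ε (fun j => x (some j)) + x none)
        (fun a => ∑ k, gordonLeft w a k * ξ k) ∂(stdPi (Option I × Option J))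
      ≤ ∫ ξ, softMinExp K p (fun x : Option J → ℝ => softNorm ε (fun j => x (some j)) + x none)
        (fun a => ∑ k, gordonRight w a k * ξ k) ∂(stdPi (Option I × Option J)) := by
  obtain ⟨f1, f2, h, hnone, hgrad⟩ := boundedC2_softNorm_add (J := J) hε
  refine integral_softMinExp_le h hnone hgrad hK hp0 hp1 _ _ ?_ (fun u v => ∑ i, w u i * w v i)
    ?_ ?_ ?_ ?_ ?_
  · rintro ⟨u, _ | i⟩ ⟨v, _ | j⟩ <;>
      simp [Fintype.sum_prod_type, Fintype.sum_option, gordonLeft, gordonRight]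
  · intro u v
    calc ∑ i, w u i * w v i ≤ ∑ i, (w u i ^ 2 + w v i ^ 2) / 2 :=
          Finset.sum_le_sum fun i _ => by nlinarith [sq_nonneg (w u i - w v i)]
      _ = 1 := by rw [← Finset.sum_div, Finset.sum_add_distrib, hw, hw]; norm_num
  · intro u
    simp_rw [← sq, hw]
  · intro u i v j
    by_cases hij : i = j
    · subst hij
      simp [Fintype.sum_prod_type, Fintype.sum_option, gordonLeft, gordonRight]
    · simp [Fintype.sum_prod_type, Fintype.sum_option, gordonLeft, gordonRight, hij]
  · intro u v
    simp [Fintype.sum_prod_type, Fintype.sum_option, gordonLeft, gordonRight]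
  · intro u v j
    simp [Fintype.sum_prod_type, Fintype.sum_option, gordonLeft, gordonRight]

lemma integrable_softMinExp_softNorm_add {κ : Type*} [Fintype κ] {ε : ℝ} (hε : 0 < ε) {K p : ℝ}
    (hK : 0 < K) (hp0 : 0 < p) (A : U × Option J → κ → ℝ) :
    Integrable (fun ξ => softMinExp K p
      (fun x : Option J → ℝ => softNorm ε (fun j => x (some j)) + x none)
      fun a => ∑ k, A a k * ξ k) (stdPi κ) := by
  obtain ⟨f1, f2, h, -, -⟩ := boundedC2_softNorm_add (J := J) hε
  exact ((h.tame_softMinExp hK hp0).comp_linear A).integrable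

lemma integral_exp_mul_stdPi_unit (t : ℝ) :
    ∫ x : Unit → ℝ, Real.exp (t * x ()) ∂(stdPi Unit) = Real.exp (t ^ 2 / 2) := by
  have mp : MeasurePreserving _ (stdPi Unit) (gaussianReal 0 1) :=
    measurePreserving_eval (fun _ : Unit => gaussianReal 0 1) ()
  have h := congrFun (mgf_id_gaussianReal (μ := 0) (v := 1)) t
  rw [mgf, ← mp.map_eq, integral_map mp.measurable.aemeasurable (by fun_prop)] at h
  simpa using h

lemma measureReal_exists_softNorm_lt_le_aux (w : U → I → ℝ) (hw : ∀ u, ∑ i, w u i ^ 2 = 1)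
    (τ : ℝ) {l p ε : ℝ} (hl : 0 < l) (hp0 : 0 < p) (hp1 : p ≤ 1) (hε : 0 < ε) :
    (stdPi (I × J)).real {G | ∃ u, softNorm 0 (fun j => ∑ i, w u i * G (i, j)) < τ}
      ≤ Real.exp (p * Real.log (Fintype.card U) + l ^ 2 / 2 +
        l * (τ + ∫ x, softNorm 0 x ∂(stdPi I) - ∫ x, softNorm 0 x ∂(stdPi J) + 2 * ε)) := by
  classical
  set E : Set (I × J → ℝ) := {G | ∃ u, softNorm 0 (fun j => ∑ i, w u i * G (i, j)) < τ} with hE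
  have hEm : MeasurableSet E := by
    have : E = ⋃ u, {G : I × J → ℝ | softNorm 0 (fun j => ∑ i, w u i * G (i, j)) < τ} := by
      ext; simp [hE]
    rw [this]
    refine MeasurableSet.iUnion fun u => measurableSet_lt ?_ measurable_const
    exact (measurable_softNorm 0).comp (by fun_prop)
  set K := l / p with hKdef
  have hK : 0 < K := div_pos hl hp0
  have hpK : p * K = l := by rw [hKdef]; field_simp
  have main := gordon_comparison (J := J) w hw hε hK hp0 hp1
  set f : (Option J → ℝ) → ℝ := fun x => softNorm ε (fun j => x (some j)) + x none with hf
  have eA : ∀ ξ : Option I × Option J → ℝ, softMinExp K p f (fun a => ∑ k, gordonLeft w a k * ξ k)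
      = Real.exp (p * Real.log (∑ u, Real.exp (-K * (softNorm ε
        (fun j => ∑ i, w u i * ξ (some i, some j)) + ξ (none, none))))) := by
    intro ξ
    simp [softMinExp, hf, gordonLeft, Fintype.sum_prod_type, Fintype.sum_option]
  have eB : ∀ ξ : Option I × Option J → ℝ, softMinExp K p f (fun a => ∑ k, gordonRight w a k * ξ k)
      = Real.exp (p * Real.log (∑ u, Real.exp (-K * (softNorm ε
        (fun j => ξ (none, some j)) + ∑ i, w u i * ξ (some i, none))))) := by
    intro ξ
    simp [softMinExp, hf, gordonRight, Fintype.sum_prod_type, Fintype.sum_option]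
  simp_rw [eA, eB] at main
  have lower : Real.exp (-l * (τ + ε)) * ((stdPi (I × J)).real E * Real.exp (l ^ 2 / 2))
      ≤ ∫ ξ : Option I × Option J → ℝ, Real.exp (p * Real.log (∑ u, Real.exp (-K * (softNorm ε
        (fun j => ∑ i, w u i * ξ (some i, some j)) + ξ (none, none))))) ∂(stdPi _) := by
    have hinj : Function.Injective (Sum.elim (fun q : I × J => (some q.1, some q.2))
        fun _ : Unit => ((none : Option I), (none : Option J))) := by
      rintro (⟨i, j⟩ | _) (⟨i', j'⟩ | _) <;> simp
    rw [← neg_sq, ← integral_exp_mul_stdPi_unit, ← integral_indicator_one hEm,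
      ← integral_mul_of_disjoint_coords hinj (measurable_one.indicator hEm) (by fun_prop),
      ← integral_const_mul]
    refine integral_mono_of_nonneg (ae_of_all _ fun ξ => ?_) ?_ (ae_of_all _ fun ξ => ?_)
    · refine mul_nonneg (Real.exp_pos _).le (mul_nonneg ?_ (Real.exp_pos _).le)
      exact Set.indicator_nonneg (fun _ _ => zero_le_one) _
    · exact (integrable_softMinExp_softNorm_add hε hK hp0 (gordonLeft w)).congr (ae_of_all _ eA)
    · simp only
      by_cases hξ : (fun q : I × J => ξ (some q.1, some q.2)) ∈ E
      · rw [Set.indicator_of_mem hξ, Pi.one_apply, one_mul, ← Real.exp_add, Real.exp_le_exp]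
        obtain ⟨u, hu⟩ := hξ
        have h1 := softNorm_le hε.le fun j => ∑ i, w u i * ξ (some i, some j)
        set z : U → ℝ := fun u =>
          softNorm ε (fun j => ∑ i, w u i * ξ (some i, some j)) + ξ (none, none) with hz
        have h2 : -K * z u ≤ Real.log (∑ u, Real.exp (-K * z u)) := by
          rw [Real.le_log_iff_exp_le (Finset.sum_pos (fun u _ => Real.exp_pos _)
            Finset.univ_nonempty)]
          exact Finset.single_le_sum (f := fun u => Real.exp (-K * z u))
            (fun _ _ => (Real.exp_pos _).le) (Finset.mem_univ u)
        have h3 : z u ≤ τ + ε + ξ (none, none) := by simp only [hz]; linarith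
        calc -l * (τ + ε) + -l * ξ (none, none) = -(l * (τ + ε + ξ (none, none))) := by ring
          _ ≤ -(l * z u) := neg_le_neg (mul_le_mul_of_nonneg_left h3 hl.le)
          _ = p * (-K * z u) := by rw [← hpK]; ring
          _ ≤ _ := mul_le_mul_of_nonneg_left h2 hp0.le
      · rw [Set.indicator_of_notMem hξ, zero_mul, mul_zero]
        exact (Real.exp_pos _).le
  have upper : ∫ ξ : Option I × Option J → ℝ, Real.exp (p * Real.log (∑ u, Real.exp (-K *
        (softNorm ε (fun j => ξ (none, some j)) + ∑ i, w u i * ξ (some i, none))))) ∂(stdPi _)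
      ≤ Real.exp (p * Real.log (Fintype.card U)) * (
        Real.exp (l ^ 2 / 2 - l * ∫ x, softNorm 0 x ∂(stdPi J)) *
        Real.exp (l ^ 2 / 2 + l * (∫ x, softNorm 0 x ∂(stdPi I) + ε))) := by
    have hinj : Function.Injective (Sum.elim (fun j : J => ((none : Option I), some j))
        fun i : I => (some i, (none : Option J))) := by
      rintro (j | i) (j' | i') <;> simp
    have tJ := (boundedC2_softNorm (J := J) hε).tame_exp (-l)
    have tI := (boundedC2_softNorm (J := I) hε).tame_exp l
    have b1 : ∫ x : J → ℝ, Real.exp (-l * softNorm ε x) ∂(stdPi J)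
        ≤ Real.exp (l ^ 2 / 2 - l * ∫ x, softNorm 0 x ∂(stdPi J)) := by
      refine (integral_exp_softNorm_le hε (-l)).trans (Real.exp_le_exp.2 ?_)
      nlinarith [integral_softNorm_zero_le (J := J) hε]
    have b2 : ∫ x : I → ℝ, Real.exp (l * softNorm ε x) ∂(stdPi I)
        ≤ Real.exp (l ^ 2 / 2 + l * (∫ x, softNorm 0 x ∂(stdPi I) + ε)) := by
      refine (integral_exp_softNorm_le hε l).trans (Real.exp_le_exp.2 ?_)
      nlinarith [integral_softNorm_le (J := I) hε]
    refine le_trans ?_ (mul_le_mul_of_nonneg_left (mul_le_mul b1 b2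
      (integral_nonneg fun _ => (Real.exp_pos _).le) (Real.exp_pos _).le) (Real.exp_pos _).le)
    rw [← integral_mul_of_disjoint_coords hinj tJ.1 tI.1, ← integral_const_mul]
    refine integral_mono_of_nonneg (ae_of_all _ fun ξ => (Real.exp_pos _).le) ?_
      (ae_of_all _ fun ξ => ?_)
    · refine ((Tame.const _).mul (Tame.mul ?_ ?_)).integrable
      · exact tJ.comp (by fun_prop) 1 zero_le_one fun ξ a =>
          (Finset.single_le_sum (f := fun k => |ξ k|) (fun _ _ => abs_nonneg _)
            (Finset.mem_univ _)).trans_eq (one_mul _).symm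
      · exact tI.comp (by fun_prop) 1 zero_le_one fun ξ a =>
          (Finset.single_le_sum (f := fun k => |ξ k|) (fun _ _ => abs_nonneg _)
            (Finset.mem_univ _)).trans_eq (one_mul _).symm
    · simp only
      rw [← Real.exp_add, ← Real.exp_add, Real.exp_le_exp]
      set h0 := softNorm ε fun j => ξ (none, some j)
      set g0 := softNorm ε fun i => ξ (some i, none)
      have h2 : Real.log (∑ u, Real.exp (-K * (h0 + ∑ i, w u i * ξ (some i, none))))
          ≤ Real.log (Fintype.card U) + K * (g0 - h0) := by
        rw [Real.log_le_iff_le_exp (Finset.sum_pos (fun u _ => Real.exp_pos _)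
            Finset.univ_nonempty), Real.exp_add, Real.exp_log (by exact_mod_cast Fintype.card_pos)]
        refine (Finset.sum_le_card_nsmul _ _ (Real.exp (K * (g0 - h0))) fun u _ =>
          Real.exp_le_exp.2 ?_).trans (by simp)
        have h3 := (neg_abs_le _).trans' (neg_le_neg ((abs_sum_mul_le_softNorm (hw u)
          fun i => ξ (some i, none)).trans (softNorm_zero_le ε _)))
        nlinarith
      calc _ ≤ p * (Real.log (Fintype.card U) + K * (g0 - h0)) :=
            mul_le_mul_of_nonneg_left h2 hp0.le
        _ = _ := by rw [← hpK]; ring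
  have h := lower.trans (main.trans upper)
  rw [mul_left_comm, ← Real.exp_add, ← Real.exp_add, ← Real.exp_add, ← le_div_iff₀ (Real.exp_pos _),
    ← Real.exp_sub] at h
  refine h.trans (Real.exp_le_exp.2 (le_of_eq ?_))
  ring

/-- Gordon's lower tail bound for the smallest value of `‖uᵀG‖` over a finite set of unit vectors. -/
lemma measureReal_exists_softNorm_lt_le (w : U → I → ℝ) (hw : ∀ u, ∑ i, w u i ^ 2 = 1)
    (τ : ℝ) {l : ℝ} (hl : 0 < l) :
    (stdPi (I × J)).real {G | ∃ u, softNorm 0 (fun j => ∑ i, w u i * G (i, j)) < τ}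
      ≤ Real.exp (l ^ 2 / 2 +
        l * (τ + ∫ x, softNorm 0 x ∂(stdPi I) - ∫ x, softNorm 0 x ∂(stdPi J))) := by
  have key : ∀ r : ℕ, _ := fun r => measureReal_exists_softNorm_lt_le_aux (J := J) w hw τ hl
    (p := 1 / ((r : ℝ) + 1)) (ε := 1 / ((r : ℝ) + 1)) (by positivity)
    (by rw [div_le_one (by positivity)]; linarith [(Nat.cast_nonneg r : (0 : ℝ) ≤ r)])
    (by positivity)
  refine ge_of_tendsto' (x := Filter.atTop) ?_ key
  refine (Real.continuous_exp.tendsto _).comp ?_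
  have h0 := tendsto_one_div_add_atTop_nhds_zero_nat (𝕜 := ℝ)
  have h1 := ((h0.mul_const (Real.log (Fintype.card U))).add_const (l ^ 2 / 2)).add
    (((h0.const_mul 2).const_add (τ + ∫ x, softNorm 0 x ∂(stdPi I)
      - ∫ x, softNorm 0 x ∂(stdPi J))).const_mul l)
  simpa using h1

end Gordon

lemma measureReal_exists_nat_softNorm_lt_le {n N : ℕ} (hn : 0 < n) (h : n ≤ N)
    (w : ℕ → Fin n → ℝ) (hw : ∀ k, ∑ i, w k i ^ 2 = 1) {l : ℝ} (hl : 0 < l) :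
    stdPi (Fin n × Fin N) {G | ∃ k, softNorm 0 (fun j => ∑ i, w k i * G (i, j))
      < Real.sqrt N - Real.sqrt n - l} ≤ ENNReal.ofReal (Real.exp (-(l ^ 2 / 2))) := by
  set τ := Real.sqrt N - Real.sqrt n - l with hτ
  set s : ℕ → Set (Fin n × Fin N → ℝ) := fun m =>
    {G | ∃ k : Fin (m + 1), softNorm 0 (fun j => ∑ i, w k i * G (i, j)) < τ} with hs
  have hmono : Monotone s := by
    rintro a b hab G ⟨k, hk⟩
    exact ⟨Fin.castLE (by omega) k, hk⟩
  have hU : {G : Fin n × Fin N → ℝ | ∃ k, softNorm 0 (fun j => ∑ i, w k i * G (i, j)) < τ}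
      = ⋃ m, s m := by
    ext G
    simp only [Set.mem_ofPred_eq, Set.mem_iUnion, hs]
    exact ⟨fun ⟨k, hk⟩ => ⟨k, Fin.last k, hk⟩, fun ⟨_, k, hk⟩ => ⟨k, hk⟩⟩
  rw [hU, hmono.measure_iUnion]
  refine iSup_le fun m => ?_
  rw [← ofReal_measureReal]
  refine ENNReal.ofReal_le_ofReal ((measureReal_exists_softNorm_lt_le
    (fun k : Fin (m + 1) => w k) (fun k => hw k) τ hl).trans (Real.exp_le_exp.2 ?_))
  have hχ := mul_le_mul_of_nonneg_left (sqrt_sub_sqrt_le_chiMean_sub hn h) hl.le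
  simp only [chiMean] at hχ
  rw [hτ]
  nlinarith

lemma exists_lamMin_mul_transpose_eq {n J : Type*} [Fintype n] [DecidableEq n] [Nonempty n]
    [Fintype J] (M : Matrix n J ℝ) :
    ∃ v : n → ℝ, ∑ i, v i ^ 2 = 1 ∧ lamMin (M * Mᵀ) = ∑ j, (∑ i, v i * M i j) ^ 2 := by
  have hM : (M * Mᵀ).IsHermitian := by
    simpa using isHermitian_mul_conjTranspose_self M
  obtain ⟨i, hi⟩ := exists_eq_ciInf_of_finite (f := hM.eigenvalues)
  have hv := hM.mulVec_eigenvectorBasis i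
  set v : n → ℝ := (hM.eigenvectorBasis i).ofLp with hvdef
  have h1 : ∑ i, v i ^ 2 = 1 := by
    have := hM.eigenvectorBasis.orthonormal.1 i
    rw [EuclideanSpace.norm_eq, Real.sqrt_eq_one] at this
    simpa using this
  refine ⟨v, h1, ?_⟩
  rw [lamMin, dif_pos hM, ← hi]
  have h2 : v ⬝ᵥ ((M * Mᵀ) *ᵥ v) = (v ᵥ* M) ⬝ᵥ (v ᵥ* M) := by
    rw [← mulVec_mulVec, dotProduct_mulVec, mulVec_transpose]
  rw [hv, dotProduct_smul] at h2
  have h3 : v ⬝ᵥ v = 1 := by rw [← h1]; simp [dotProduct, sq]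
  rw [h3, smul_eq_mul, mul_one] at h2
  rw [h2]
  simp [dotProduct, vecMul, sq]

lemma exists_seq_sqrt_lamMin_lt {n J : Type*} [Fintype n] [DecidableEq n] [Nonempty n]
    [Fintype J] : ∃ w : ℕ → n → ℝ, (∀ k, ∑ i, w k i ^ 2 = 1) ∧ ∀ (M : Matrix n J ℝ) (τ : ℝ),
      Real.sqrt (lamMin (M * Mᵀ)) < τ → ∃ k, softNorm 0 (fun j => ∑ i, w k i * M i j) < τ := by
  have : Nonempty {v : n → ℝ // ∑ i, v i ^ 2 = 1} :=
    ⟨_, (exists_lamMin_mul_transpose_eq (0 : Matrix n J ℝ)).choose_spec.1⟩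
  refine ⟨fun k => TopologicalSpace.denseSeq {v : n → ℝ // ∑ i, v i ^ 2 = 1} k,
    fun k => (TopologicalSpace.denseSeq {v : n → ℝ // ∑ i, v i ^ 2 = 1} k).2, fun M τ h => ?_⟩
  obtain ⟨v, hv, e⟩ := exists_lamMin_mul_transpose_eq M
  have ho : IsOpen {v : {v : n → ℝ // ∑ i, v i ^ 2 = 1} |
      softNorm 0 (fun j => ∑ i, v.1 i * M i j) < τ} := by
    have hc : Continuous fun v : n → ℝ => softNorm 0 fun j => ∑ i, v i * M i j := by
      simp only [softNorm]
      fun_prop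
    exact isOpen_lt (hc.comp continuous_subtype_val) continuous_const
  refine (TopologicalSpace.denseRange_denseSeq _).exists_mem_open ho ⟨⟨v, hv⟩, ?_⟩
  rw [e] at h
  simpa [softNorm] using h

lemma measurePreserving_const_mul_gaussian {κ : Type*} [Fintype κ] (σ : ℝ) :
    MeasurePreserving (fun (ω : κ → ℝ) k => σ * ω k) (stdPi κ)
      (Measure.pi fun _ => gaussianReal 0 (NNReal.mk (σ ^ 2) (sq_nonneg σ))) :=
  measurePreserving_pi _ _ fun _ => ⟨measurable_const_mul σ, by
    rw [gaussianReal_map_const_mul]; simp⟩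

lemma softNorm_zero_const_mul {J : Type*} [Fintype J] {σ : ℝ} (hσ : 0 ≤ σ) (x : J → ℝ) :
    softNorm 0 (fun j => σ * x j) = σ * softNorm 0 x := by
  simp only [softNorm, mul_pow, ← Finset.mul_sum]
  rw [zero_pow two_ne_zero, zero_add, zero_add, Real.sqrt_mul (sq_nonneg σ), Real.sqrt_sq hσ]

/-- For a random n×N real matrix `Ψ` with i.i.d. `N(0, σ²)` entries,
with probability at least `1−δ`, `√(λ_min(Ψ Ψᵀ)) ≥ σ(√N − √n − √(2·log(1/δ)))`. -/
theorem stmt1 (n N : ℕ) (hn : 0 < n) (hN : 0 < N)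
    (δ : ℝ) (hδ : δ ∈ Set.Ioo (0 : ℝ) 1) (σ : ℝ) (hσ : 0 < σ) :
    (Measure.pi fun _ : Fin n × Fin N => gaussianReal 0 ⟨σ ^ 2, sq_nonneg σ⟩)
      {ω : (Fin n × Fin N) → ℝ |
        Real.sqrt (lamMin ((Matrix.of fun (i : Fin n) (j : Fin N) => ω (i, j)) *
            (Matrix.of fun (i : Fin n) (j : Fin N) => ω (i, j))ᵀ))
          ≥ σ * (Real.sqrt (N : ℝ) - Real.sqrt (n : ℝ) - Real.sqrt (2 * Real.log (1 / δ)))}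
      ≥ ENNReal.ofReal (1 - δ) := by
  obtain ⟨hδ0, hδ1⟩ := hδ
  have hlog : 0 < Real.log (1 / δ) := Real.log_pos (by rw [lt_div_iff₀ hδ0]; linarith)
  set l := Real.sqrt (2 * Real.log (1 / δ)) with hl
  have hl0 : 0 < l := Real.sqrt_pos.2 (by linarith)
  have hexp : Real.exp (-(l ^ 2 / 2)) = δ := by
    rw [hl, Real.sq_sqrt (by linarith), mul_div_cancel_left₀ _ two_ne_zero, one_div, Real.log_inv,
      neg_neg, Real.exp_log hδ0]
  set μ : Measure (Fin n × Fin N → ℝ) := Measure.pi fun _ : Fin n × Fin N => gaussianReal 0 (NNReal.mk (σ ^ 2) (sq_nonneg σ)) with hμ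
  change μ _ ≥ _
  rcases le_or_gt n N with hnN | hnN
  · have : Nonempty (Fin n) := ⟨⟨0, hn⟩⟩
    obtain ⟨w, hw, hlt⟩ := exists_seq_sqrt_lamMin_lt (n := Fin n) (J := Fin N)
    set τ := Real.sqrt N - Real.sqrt n - l with hτ
    set B : Set (Fin n × Fin N → ℝ) :=
      {ω | ∃ k, softNorm 0 (fun j => ∑ i, w k i * ω (i, j)) < σ * τ} with hB
    have hBm : MeasurableSet B := by
      simp only [hB, Set.ofPred_exists]
      exact MeasurableSet.iUnion fun k => measurableSet_lt (by fun_prop) measurable_const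
    have hμB : μ B ≤ ENNReal.ofReal δ := by
      rw [hμ, ← (measurePreserving_const_mul_gaussian σ).measure_preimage hBm.nullMeasurableSet,
        ← hexp]
      refine (measure_mono ?_).trans (measureReal_exists_nat_softNorm_lt_le hn hnN w hw hl0)
      rintro G ⟨k, hk⟩
      refine ⟨k, ?_⟩
      simp only [mul_left_comm _ σ, ← Finset.mul_sum] at hk
      rw [softNorm_zero_const_mul hσ.le] at hk
      exact lt_of_mul_lt_mul_left hk hσ.le
    calc ENNReal.ofReal (1 - δ) = 1 - ENNReal.ofReal δ := by
          rw [ENNReal.ofReal_sub _ hδ0.le, ENNReal.ofReal_one]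
      _ ≤ 1 - μ B := tsub_le_tsub_left hμB 1
      _ = μ Bᶜ := (prob_compl_eq_one_sub hBm).symm
      _ ≤ _ := measure_mono fun ω hω => not_lt.1 fun h => hω (hlt _ _ h)
  · have h1 : Real.sqrt N ≤ Real.sqrt n := Real.sqrt_le_sqrt (by exact_mod_cast hnN.le)
    have h2 : ∀ ω : Fin n × Fin N → ℝ,
        Real.sqrt (lamMin ((Matrix.of fun (i : Fin n) (j : Fin N) => ω (i, j)) *
            (Matrix.of fun (i : Fin n) (j : Fin N) => ω (i, j))ᵀ))
          ≥ σ * (Real.sqrt N - Real.sqrt n - l) := fun ω =>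
      (mul_nonpos_of_nonneg_of_nonpos hσ.le (by linarith)).trans (Real.sqrt_nonneg _)
    simp only [h2, Set.ofPred_true, measure_univ]
    exact ENNReal.ofReal_le_one.2 (by linarith)
end

section
/- Let G and Ĝ be real q×n matrices such that GᵀG is positive definite (i.e., G has full column rank). Let ε ≥ 0 satisfy ‖Ĝ − G‖₂ ≤ ε and ε < √(‖G‖₂² + λ_min(GᵀG)) − ‖G‖₂. Then ĜᵀĜ − (λ_min(GᵀG) − ε² − 2ε‖G‖₂)·I_n is positive semidefinite, the scalar λ_min(GᵀG) − ε² − 2ε‖G‖₂ is positive, and consequently ĜᵀĜ is positive definite, i.e., Ĝ has full column rank. -/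
open Matrix

/-- The spectral norm (ℓ²→ℓ² operator norm) of a real matrix. -/
noncomputable def specNorm {m n : Type*} [Fintype m] [Fintype n] [DecidableEq n]
    (A : Matrix m n ℝ) : ℝ :=
  ‖LinearMap.toContinuousLinearMap (Matrix.toEuclideanLin A)‖

open scoped MatrixOrder in
theorem posSemidef_sub_lamMin_smul_one {n : Type*} [Fintype n] [DecidableEq n]
    {S : Matrix n n ℝ} (hS : S.IsHermitian) :
    (S - lamMin S • (1 : Matrix n n ℝ)).PosSemidef := by
  rw [← Matrix.le_iff, ← Algebra.algebraMap_eq_smul_one]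
  refine algebraMap_le_of_le_spectrum (fun x hx => ?_) hS.isSelfAdjoint
  rw [hS.spectrum_real_eq_range_eigenvalues] at hx
  obtain ⟨i, rfl⟩ := hx
  rw [lamMin, dif_pos hS]
  exact ciInf_le (Set.finite_range _).bddBelow i

theorem lamMin_mul_dotProduct_le {n : Type*} [Fintype n] [DecidableEq n]
    {S : Matrix n n ℝ} (hS : S.IsHermitian) (x : n → ℝ) :
    lamMin S * (x ⬝ᵥ x) ≤ x ⬝ᵥ S *ᵥ x := by
  have h := (posSemidef_sub_lamMin_smul_one hS).dotProduct_mulVec_nonneg x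
  simpa [sub_mulVec, smul_mulVec, dotProduct_sub] using h

theorem dotProduct_transpose_mul_self_mulVec {m n : Type*} [Fintype m] [Fintype n]
    (A : Matrix m n ℝ) (x : n → ℝ) :
    x ⬝ᵥ (Aᵀ * A) *ᵥ x = ‖WithLp.toLp 2 (A *ᵥ x)‖ ^ 2 := by
  rw [← mulVec_mulVec, dotProduct_mulVec, vecMul_transpose, EuclideanSpace.real_norm_sq_eq]
  simp [dotProduct, sq]

theorem norm_toLp_mulVec_le_specNorm {m n : Type*} [Fintype m] [Fintype n] [DecidableEq n]
    (A : Matrix m n ℝ) (x : n → ℝ) :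
    ‖WithLp.toLp 2 (A *ᵥ x)‖ ≤ specNorm A * ‖WithLp.toLp 2 x‖ :=
  (LinearMap.toContinuousLinearMap (Matrix.toEuclideanLin A)).le_opNorm (WithLp.toLp 2 x)

/-- Proposition 2 of the paper. If `G` has full column rank and
`‖Ghat − G‖₂ ≤ ε < √(‖G‖₂² + λ_min(GᵀG)) − ‖G‖₂`, then
`GhatᵀGhat ≽ (λ_min(GᵀG) − ε² − 2ε‖G‖₂)·I ≻ 0`, so `Ghat` has full column rank. -/
theorem stmt3 {q n : ℕ} (G Ghat : Matrix (Fin q) (Fin n) ℝ)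
    (hG : (Gᵀ * G).PosDef) (ε : ℝ) (hε0 : 0 ≤ ε)
    (hclose : specNorm (Ghat - G) ≤ ε)
    (hεlt : ε < Real.sqrt (specNorm G ^ 2 + lamMin (Gᵀ * G)) - specNorm G) :
    (Ghatᵀ * Ghat - (lamMin (Gᵀ * G) - ε ^ 2 - 2 * ε * specNorm G) •
        (1 : Matrix (Fin n) (Fin n) ℝ)).PosSemidef ∧
      0 < lamMin (Gᵀ * G) - ε ^ 2 - 2 * ε * specNorm G ∧
      (Ghatᵀ * Ghat).PosDef := by
  have hpos : 0 < lamMin (Gᵀ * G) - ε ^ 2 - 2 * ε * specNorm G := by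
    have hg : 0 ≤ specNorm G := norm_nonneg _
    have h := (Real.lt_sqrt (add_nonneg hε0 hg)).1 (lt_sub_iff_add_lt.1 hεlt)
    linarith
  have hpsd : (Ghatᵀ * Ghat - (lamMin (Gᵀ * G) - ε ^ 2 - 2 * ε * specNorm G) •
      (1 : Matrix (Fin n) (Fin n) ℝ)).PosSemidef := by
    refine .of_dotProduct_mulVec_nonneg ?_ fun x => ?_
    · exact (isHermitian_conjTranspose_mul_self Ghat).sub
        (isHermitian_one.smul (IsSelfAdjoint.all _))
    have hx : x ⬝ᵥ x = ‖WithLp.toLp 2 x‖ ^ 2 := by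
      rw [EuclideanSpace.real_norm_sq_eq]
      simp [dotProduct, sq]
    have hlam := lamMin_mul_dotProduct_le hG.isHermitian x
    have hGx := norm_toLp_mulVec_le_specNorm G x
    have hΔx := (norm_toLp_mulVec_le_specNorm (Ghat - G) x).trans
      (mul_le_mul_of_nonneg_right hclose (norm_nonneg _))
    have hsplit : WithLp.toLp 2 (Ghat *ᵥ x) =
        WithLp.toLp 2 (G *ᵥ x) + WithLp.toLp 2 ((Ghat - G) *ᵥ x) := by
      rw [← WithLp.toLp_add, ← add_mulVec, add_sub_cancel]
    have hexp := norm_add_sq_real (WithLp.toLp 2 (G *ᵥ x)) (WithLp.toLp 2 ((Ghat - G) *ᵥ x))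
    rw [← hsplit] at hexp
    have hinner := neg_le_of_abs_le
      (abs_real_inner_le_norm (WithLp.toLp 2 (G *ᵥ x)) (WithLp.toLp 2 ((Ghat - G) *ᵥ x)))
    have hprod := mul_le_mul hGx hΔx (norm_nonneg _) ((norm_nonneg _).trans hGx)
    rw [dotProduct_transpose_mul_self_mulVec, hx] at hlam
    rw [star_trivial, sub_mulVec, smul_mulVec, one_mulVec, dotProduct_sub, dotProduct_smul,
      smul_eq_mul, dotProduct_transpose_mul_self_mulVec, hx]
    nlinarith [sq_nonneg ‖WithLp.toLp 2 ((Ghat - G) *ᵥ x)‖, sq_nonneg (ε * ‖WithLp.toLp 2 x‖)]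
  refine ⟨hpsd, hpos, ?_⟩
  simpa using PosDef.posSemidef_add hpsd (PosDef.one.smul hpos)
end

section
/- Let G₁, Ĝ₁, G₂, Ĝ₂ be real q×n matrices and A a real n×n matrix with G₂ = G₁·A and G₁ᵀG₁ positive definite. Suppose ε ≥ 0 satisfies ‖G₁ − Ĝ₁‖₂ ≤ ε, ‖G₂ − Ĝ₂‖₂ ≤ ε, and ε² + 2ε‖G₁‖₂ < λ_min(G₁ᵀG₁). Then Ĝ₁ᵀĜ₁ is positive definite, and the matrix Â := (Ĝ₁ᵀĜ₁)⁻¹Ĝ₁ᵀĜ₂ satisfies ‖A − Â‖₂ ≤ (‖A‖₂ + 1)·ε / √(λ_min(G₁ᵀG₁) − ε² − 2ε‖G₁‖₂). -/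
open Matrix

namespace Matrix

lemma toEuclideanLin_mul_apply {m n p : Type*} [Fintype n] [DecidableEq n] [Fintype p]
    [DecidableEq p] (M : Matrix m n ℝ) (N : Matrix n p ℝ)
    (x : EuclideanSpace ℝ p) :
    toEuclideanLin (M * N) x = toEuclideanLin M (toEuclideanLin N x) := by
  simp

variable {m n : Type*} [Fintype m] [Fintype n] [DecidableEq n]

lemma inner_toEuclideanLin_transpose_apply [DecidableEq m] (M : Matrix m n ℝ)
    (x : EuclideanSpace ℝ n) (y : EuclideanSpace ℝ m) :
    inner ℝ x (toEuclideanLin Mᵀ y) = inner ℝ (toEuclideanLin M x) y := by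
  rw [← conjTranspose_eq_transpose_of_trivial, toEuclideanLin_conjTranspose_eq_adjoint,
    LinearMap.adjoint_inner_right]

lemma inner_toEuclideanLin_transpose_mul_self [DecidableEq m] (M : Matrix m n ℝ)
    (x : EuclideanSpace ℝ n) :
    inner ℝ x (toEuclideanLin (Mᵀ * M) x) = ‖toEuclideanLin M x‖ ^ 2 := by
  rw [toEuclideanLin_mul_apply, inner_toEuclideanLin_transpose_apply, real_inner_self_eq_norm_sq]

lemma posDef_transpose_mul_self_of_forall_norm_le (M : Matrix m n ℝ) {c : ℝ} (hc : 0 < c)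
    (h : ∀ x : EuclideanSpace ℝ n, c * ‖x‖ ^ 2 ≤ ‖toEuclideanLin M x‖ ^ 2) :
    (Mᵀ * M).PosDef := by
  rw [← conjTranspose_eq_transpose_of_trivial]
  refine PosDef.conjTranspose_mul_self M ?_
  have hinj : Function.Injective (toEuclideanLin M) := by
    refine (injective_iff_map_eq_zero _).2 fun x hx => ?_
    have hle := h x
    rw [hx, norm_zero] at hle
    have : ‖x‖ ^ 2 = 0 := by nlinarith [sq_nonneg ‖x‖]
    simpa using this
  intro v w hvw
  have := hinj (a₁ := WithLp.toLp 2 v) (a₂ := WithLp.toLp 2 w) (by simpa [toLpLin_toLp] using hvw)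
  simpa using this

end Matrix

section SpectralNorm

variable {m n : Type*} [Fintype m] [Fintype n] [DecidableEq n]

lemma specNorm_nonneg (M : Matrix m n ℝ) : 0 ≤ specNorm M := norm_nonneg _

lemma norm_toEuclideanLin_le (M : Matrix m n ℝ) (x : EuclideanSpace ℝ n) :
    ‖toEuclideanLin M x‖ ≤ specNorm M * ‖x‖ :=
  (LinearMap.toContinuousLinearMap (toEuclideanLin M)).le_opNorm x

lemma specNorm_le {M : Matrix m n ℝ} {c : ℝ} (hc : 0 ≤ c)
    (h : ∀ x : EuclideanSpace ℝ n, ‖toEuclideanLin M x‖ ≤ c * ‖x‖) : specNorm M ≤ c :=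
  ContinuousLinearMap.opNorm_le_bound _ hc h

/-- The Rayleigh quotient of a symmetric matrix is bounded below by its smallest eigenvalue. -/
lemma lamMin_mul_norm_sq_le_inner {S : Matrix n n ℝ} (hS : S.IsHermitian)
    (x : EuclideanSpace ℝ n) : lamMin S * ‖x‖ ^ 2 ≤ inner ℝ x (toEuclideanLin S x) := by
  have key (i : n) : inner ℝ (hS.eigenvectorBasis i) (toEuclideanLin S x)
      = hS.eigenvalues i * inner ℝ (hS.eigenvectorBasis i) x := by
    have hb : toEuclideanLin S (hS.eigenvectorBasis i)
        = hS.eigenvalues i • hS.eigenvectorBasis i := by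
      ext j
      simpa [toLpLin_apply] using congrFun (hS.mulVec_eigenvectorBasis i) j
    rw [← (isSymmetric_toEuclideanLin_iff.mpr hS) (hS.eigenvectorBasis i) x, hb,
      real_inner_smul_left]
  rw [lamMin, dif_pos hS, ← real_inner_self_eq_norm_sq,
    ← hS.eigenvectorBasis.sum_inner_mul_inner x x,
    ← hS.eigenvectorBasis.sum_inner_mul_inner x (toEuclideanLin S x), Finset.mul_sum]
  refine Finset.sum_le_sum fun i _ => ?_
  rw [key, real_inner_comm (hS.eigenvectorBasis i) x]
  have hi : ⨅ j, hS.eigenvalues j ≤ hS.eigenvalues i :=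
    ciInf_le (Set.finite_range _).bddBelow i
  nlinarith [mul_le_mul_of_nonneg_right hi (sq_nonneg (inner ℝ (hS.eigenvectorBasis i) x))]

/-- A perturbation of size `ε` lowers the squared lower bound of a matrix by at most
`ε² + 2ε‖M‖₂`. -/
lemma lamMin_sub_mul_norm_sq_le_of_specNorm_sub_le [DecidableEq m] {M N : Matrix m n ℝ} {ε : ℝ}
    (hε : 0 ≤ ε) (hMN : specNorm (M - N) ≤ ε)
    (hsmall : ε ^ 2 + 2 * ε * specNorm M < lamMin (Mᵀ * M)) (x : EuclideanSpace ℝ n) :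
    (lamMin (Mᵀ * M) - ε ^ 2 - 2 * ε * specNorm M) * ‖x‖ ^ 2 ≤ ‖toEuclideanLin N x‖ ^ 2 := by
  have hlow : lamMin (Mᵀ * M) * ‖x‖ ^ 2 ≤ ‖toEuclideanLin M x‖ ^ 2 := by
    rw [← inner_toEuclideanLin_transpose_mul_self]
    exact lamMin_mul_norm_sq_le_inner
      (by simpa using isHermitian_conjTranspose_mul_self M) x
  have hup := norm_toEuclideanLin_le M x
  have hdiff : ‖toEuclideanLin M x - toEuclideanLin N x‖ ≤ ε * ‖x‖ := by
    have := norm_toEuclideanLin_le (M - N) x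
    rw [map_sub, LinearMap.sub_apply] at this
    exact this.trans (mul_le_mul_of_nonneg_right hMN (norm_nonneg x))
  have htri := norm_sub_norm_le (toEuclideanLin M x) (toEuclideanLin N x)
  have hs := specNorm_nonneg M
  have hx := norm_nonneg x
  have hεx : 0 ≤ ε * ‖x‖ := mul_nonneg hε hx
  have hεM : ε * ‖x‖ ≤ ‖toEuclideanLin M x‖ := by
    refine abs_le_of_sq_le_sq' ?_ (norm_nonneg _) |>.2
    nlinarith [mul_nonneg hε hs, sq_nonneg ‖x‖,
      mul_nonneg (mul_nonneg hε hs) (sq_nonneg ‖x‖),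
      mul_le_mul_of_nonneg_right hsmall.le (sq_nonneg ‖x‖)]
  have hsq : (‖toEuclideanLin M x‖ - ε * ‖x‖) ^ 2 ≤ ‖toEuclideanLin N x‖ ^ 2 :=
    pow_le_pow_left₀ (by linarith) (by linarith) 2
  nlinarith [mul_le_mul_of_nonneg_left hup hεx, sq_nonneg (ε * ‖x‖)]

end SpectralNorm

/-- accuracy of the identified system matrix, cf. Proposition 3.
If `G₂ = G₁·A`, `G₁` has full column rank, `‖G₁ − Ĝ₁‖₂ ≤ ε`, `‖G₂ − Ĝ₂‖₂ ≤ ε` and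
`ε² + 2ε‖G₁‖₂ < λ_min(G₁ᵀG₁)`, then `Ĝ₁ᵀĜ₁` is positive definite and
`Â = (Ĝ₁ᵀĜ₁)⁻¹Ĝ₁ᵀĜ₂` satisfies
`‖A − Â‖₂ ≤ (‖A‖₂+1)·ε/√(λ_min(G₁ᵀG₁) − ε² − 2ε‖G₁‖₂)`. -/
theorem stmt7 {q n : ℕ} (G₁ Ghat₁ G₂ Ghat₂ : Matrix (Fin q) (Fin n) ℝ)
    (A : Matrix (Fin n) (Fin n) ℝ) (hG₂ : G₂ = G₁ * A)
    (hG₁ : (G₁ᵀ * G₁).PosDef) (ε : ℝ) (hε0 : 0 ≤ ε)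
    (h₁ : specNorm (G₁ - Ghat₁) ≤ ε) (h₂ : specNorm (G₂ - Ghat₂) ≤ ε)
    (hεsmall : ε ^ 2 + 2 * ε * specNorm G₁ < lamMin (G₁ᵀ * G₁)) :
    (Ghat₁ᵀ * Ghat₁).PosDef ∧
      specNorm (A - (Ghat₁ᵀ * Ghat₁)⁻¹ * Ghat₁ᵀ * Ghat₂) ≤
        (specNorm A + 1) * ε /
          Real.sqrt (lamMin (G₁ᵀ * G₁) - ε ^ 2 - 2 * ε * specNorm G₁) := by
  have hc : 0 < lamMin (G₁ᵀ * G₁) - ε ^ 2 - 2 * ε * specNorm G₁ := by linarith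
  have hlow := lamMin_sub_mul_norm_sq_le_of_specNorm_sub_le hε0 h₁ hεsmall
  set c := lamMin (G₁ᵀ * G₁) - ε ^ 2 - 2 * ε * specNorm G₁
  have hpd := posDef_transpose_mul_self_of_forall_norm_le Ghat₁ hc hlow
  have hA := specNorm_nonneg A
  refine ⟨hpd, specNorm_le (by positivity) fun x => ?_⟩
  set D := A - (Ghat₁ᵀ * Ghat₁)⁻¹ * Ghat₁ᵀ * Ghat₂
  set E := (G₂ - Ghat₂) - (G₁ - Ghat₁) * A with hE
  have hnormal : Ghat₁ᵀ * Ghat₁ * D = Ghat₁ᵀ * E := by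
    have hunit : IsUnit (Ghat₁ᵀ * Ghat₁).det := hpd.det_pos.ne'.isUnit
    have hEeq : E = Ghat₁ * A - Ghat₂ := by
      rw [hE, hG₂, Matrix.sub_mul]
      abel
    rw [hEeq, Matrix.mul_sub, Matrix.mul_sub, Matrix.mul_assoc _ Ghat₁ᵀ Ghat₂,
      mul_nonsing_inv_cancel_left _ _ hunit, Matrix.mul_assoc]
  set y := toEuclideanLin D x with hy
  have hEx : ‖toEuclideanLin E x‖ ≤ (specNorm A + 1) * ε * ‖x‖ := by
    have hsub : toEuclideanLin E x = toEuclideanLin (G₂ - Ghat₂) x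
        - toEuclideanLin (G₁ - Ghat₁) (toEuclideanLin A x) := by
      rw [← toEuclideanLin_mul_apply, ← LinearMap.sub_apply, ← map_sub]
    calc ‖toEuclideanLin E x‖
        ≤ ‖toEuclideanLin (G₂ - Ghat₂) x‖
          + ‖toEuclideanLin (G₁ - Ghat₁) (toEuclideanLin A x)‖ := hsub ▸ norm_sub_le _ _
      _ ≤ ε * ‖x‖ + ε * (specNorm A * ‖x‖) := by
        refine add_le_add ((norm_toEuclideanLin_le _ _).trans (by gcongr))
          ((norm_toEuclideanLin_le _ _).trans ?_)
        exact mul_le_mul h₁ (norm_toEuclideanLin_le _ _) (norm_nonneg _) hε0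
      _ = (specNorm A + 1) * ε * ‖x‖ := by ring
  have hGy : ‖toEuclideanLin Ghat₁ y‖ ≤ ‖toEuclideanLin E x‖ := by
    have hsq : ‖toEuclideanLin Ghat₁ y‖ ^ 2
        ≤ ‖toEuclideanLin Ghat₁ y‖ * ‖toEuclideanLin E x‖ := by
      rw [← inner_toEuclideanLin_transpose_mul_self]
      nth_rewrite 2 [hy]
      rw [← toEuclideanLin_mul_apply, hnormal, toEuclideanLin_mul_apply,
        inner_toEuclideanLin_transpose_apply]
      exact real_inner_le_norm _ _
    nlinarith [norm_nonneg (toEuclideanLin Ghat₁ y), norm_nonneg (toEuclideanLin E x)]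
  have hsqrt : Real.sqrt c * ‖y‖ ≤ ‖toEuclideanLin Ghat₁ y‖ := by
    refine abs_le_of_sq_le_sq' ?_ (norm_nonneg _) |>.2
    rw [mul_pow, Real.sq_sqrt hc.le]
    exact hlow y
  rw [div_mul_eq_mul_div, le_div_iff₀ (Real.sqrt_pos.2 hc), mul_comm]
  exact hsqrt.trans (hGy.trans hEx)
end

section
/- Let A♯ be a real n×n matrix, B♯ a real n×m matrix, C♯ a real p×n matrix, Q₁ a symmetric positive definite real n×n matrix, Q₂ a real m×n matrix, Δ a symmetric positive definite real n×n matrix, and K a real m×p matrix with K·C♯·Q₁ = Q₂. If the 2n×2n block matrix with blocks [[Q₁ − Δ, A♯·Q₁ + B♯·Q₂], [(A♯·Q₁ + B♯·Q₂)ᵀ, Q₁]] is positive definite, then Q₁ − Δ − (A♯ + B♯·K·C♯)·Q₁·(A♯ + B♯·K·C♯)ᵀ is positive definite. -/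
open Matrix

/-- If a block matrix `[[P, M * Q], [(M * Q)ᵀ, Q]]` is positive definite, then so is the Schur
complement `P - M * Q * Mᵀ`. -/
theorem Matrix.PosDef.sub_mul_mul_transpose_of_fromBlocks {ι κ : Type*} [Fintype ι] [Fintype κ]
    {P : Matrix ι ι ℝ} {M : Matrix ι κ ℝ} {Q : Matrix κ κ ℝ} (hQ : Q.IsSymm)
    (h : (Matrix.fromBlocks P (M * Q) (M * Q)ᵀ Q).PosDef) : (P - M * Q * Mᵀ).PosDef := by
  classical
  have hinj : Function.Injective (Matrix.fromRows (1 : Matrix ι ι ℝ) (-Mᵀ)).mulVec := by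
    intro x y hxy
    ext i
    simpa [Matrix.fromRows_mulVec] using congrFun hxy (Sum.inl i)
  have hpos := h.conjTranspose_mul_mul_same hinj
  rwa [Matrix.conjTranspose_eq_transpose_of_trivial, Matrix.transpose_fromRows,
    Matrix.fromCols_mul_fromBlocks, Matrix.fromCols_mul_fromRows, Matrix.transpose_mul, hQ.eq,
    Matrix.transpose_neg, Matrix.transpose_transpose, Matrix.transpose_one, Matrix.one_mul,
    Matrix.one_mul, Matrix.neg_mul, Matrix.neg_mul, add_neg_cancel, Matrix.zero_mul, add_zero,
    Matrix.mul_one, ← Matrix.mul_assoc, ← sub_eq_add_neg] at hpos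

/-- data-driven static output feedback LMI, cf. Theorem 2.
If the block matrix `[[Q₁ − Δ, A♯Q₁ + B♯Q₂], [(A♯Q₁ + B♯Q₂)ᵀ, Q₁]]` is positive
definite and `K·C♯·Q₁ = Q₂`, then
`Q₁ − Δ − (A♯ + B♯KC♯)·Q₁·(A♯ + B♯KC♯)ᵀ` is positive definite. -/
theorem stmt12 {n m p : ℕ}
    (Asharp : Matrix (Fin n) (Fin n) ℝ) (Bsharp : Matrix (Fin n) (Fin m) ℝ)
    (Csharp : Matrix (Fin p) (Fin n) ℝ)
    (Q₁ : Matrix (Fin n) (Fin n) ℝ) (hQ₁ : Q₁.PosDef)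
    (Q₂ : Matrix (Fin m) (Fin n) ℝ)
    (Δ : Matrix (Fin n) (Fin n) ℝ) (hΔ : Δ.PosDef)
    (K : Matrix (Fin m) (Fin p) ℝ) (hK : K * Csharp * Q₁ = Q₂)
    (hblock : (Matrix.fromBlocks (Q₁ - Δ) (Asharp * Q₁ + Bsharp * Q₂)
        (Asharp * Q₁ + Bsharp * Q₂)ᵀ Q₁).PosDef) :
    (Q₁ - Δ - (Asharp + Bsharp * K * Csharp) * Q₁ *
        (Asharp + Bsharp * K * Csharp)ᵀ).PosDef := by
  have hM : Asharp * Q₁ + Bsharp * Q₂ = (Asharp + Bsharp * K * Csharp) * Q₁ := by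
    rw [← hK]
    simp only [Matrix.add_mul, Matrix.mul_assoc]
  rw [hM] at hblock
  exact Matrix.PosDef.sub_mul_mul_transpose_of_fromBlocks
    (Matrix.isHermitian_iff_isSymm.mp hQ₁.isHermitian) hblock
end
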